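/- Let (Ω, μ) be a probability space. The couple (V^1_1(Ω^∞, L^1(ℝ)), V^2_1(Ω^∞, L^2(ℝ))) is K-closed in (L^1(Ω^∞, L^1(ℝ)), L^2(Ω^∞, L^2(ℝ))). That is, there is an absolute constant C such that for every f ∈ V^1_1(Ω^∞, L^1(ℝ)) + V^2_1(Ω^∞, L^2(ℝ)), every t > 0, and every decomposition f = f_0 + f_1 with f_0 ∈ L^1(Ω^∞, L^1(ℝ)) and f_1 ∈ L^2(Ω^∞, L^2(ℝ)), there exists a decomposition f = g_0 + g_1 with g_0 ∈ V^1_1(Ω^∞, L^1(ℝ)), g_1 ∈ V^2_1(Ω^∞, L^2(ℝ)), and ‖g_0‖_{L^1(Ω^∞,L^1(ℝ))} + t ‖g_1‖_{L^2(Ω^∞,L^2(ℝ))} ≤ C (‖f_0‖_{L^1(Ω^∞,L^1(ℝ))} + t ‖f_1‖_{L^2(Ω^∞,L^2(ℝ))}). -/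

import Mathlib

open MeasureTheory
open scoped ENNReal

universe u

variable {Ω : Type u} [MeasurableSpace Ω]

/-- The norm of `L¹(Ω^∞, L¹(ℝ))` (for `π` the infinite product measure on `ℕ → Ω`). -/
noncomputable def nrmL1L1 (π : Measure (ℕ → Ω)) (F : (ℕ → Ω) → ℝ → ℝ) : ℝ≥0∞ :=
  ∫⁻ x : ℕ → Ω, ∫⁻ s : ℝ, ENNReal.ofReal |F x s| ∂volume ∂π

/-- The norm of `L²(Ω^∞, L²(ℝ))`. -/
noncomputable def nrmL2L2 (π : Measure (ℕ → Ω)) (F : (ℕ → Ω) → ℝ → ℝ) : ℝ≥0∞ :=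
  (∫⁻ x : ℕ → Ω, ∫⁻ s : ℝ, ENNReal.ofReal (F x s ^ 2) ∂volume ∂π) ^ ((1:ℝ)/2)

/-- Membership in `V^p_1(Ω^∞, L^p(ℝ))` (for the norm `N` of `L^p(Ω^∞, L^p(ℝ))`,
`p ∈ {1,2}`): the closure in norm `N` of the span of functions `x ↦ ∑ i, g i (x i)` with
finitely many nonzero `g i : Ω → L^p(ℝ)`, each of mean zero. -/
def MemV1inf (μ : Measure Ω)
    (N : ((ℕ → Ω) → ℝ → ℝ) → ℝ≥0∞) (F : (ℕ → Ω) → ℝ → ℝ) : Prop :=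
  Measurable (Function.uncurry F) ∧ N F < ⊤ ∧
  ∀ ε : ℝ, 0 < ε → ∃ (n : ℕ) (g : ℕ → Ω → ℝ → ℝ),
    (∀ i, Measurable (Function.uncurry (g i))) ∧
    (∀ i, ∀ᵐ s ∂(volume : Measure ℝ),
      Integrable (fun ω => g i ω s) μ ∧ ∫ ω, g i ω s ∂μ = 0) ∧
    (∀ i, N (fun x s => g i (x i) s) < ⊤) ∧
    N (fun x s => F x s - ∑ i ∈ Finset.range n, g i (x i) s) ≤ ENNReal.ofReal ε


section Helpers

open ProbabilityTheory Filter Topology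

namespace KC

section Part1

/-- Huber function. -/
noncomputable def hub (l x : ℝ) : ℝ := if |x| ≤ l then x ^ 2 else 2 * l * |x| - l ^ 2

/-- Its derivative. -/
noncomputable def hubD (l x : ℝ) : ℝ := 2 * max (-l) (min x l)

lemma hub_nonneg {l : ℝ} (hl : 0 < l) (x : ℝ) : 0 ≤ hub l x := by
  unfold hub; split_ifs with h
  · positivity
  · push Not at h; nlinarith

lemma hub_le {l : ℝ} (hl : 0 < l) (x : ℝ) : hub l x ≤ 2 * l * |x| := by
  unfold hub; split_ifs with h
  · rw [← sq_abs]; nlinarith [abs_nonneg x]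
  · nlinarith

lemma hub_le_sq {l : ℝ} (x : ℝ) : hub l x ≤ x ^ 2 := by
  unfold hub; split_ifs with h
  · exact le_rfl
  · rw [← sq_abs x]; nlinarith [sq_nonneg (|x| - l)]

lemma hub_add_le {l : ℝ} (hl : 0 < l) (a b : ℝ) : hub l (a + b) ≤ 2 * l * |a| + 2 * b ^ 2 := by
  have hab := abs_add_le a b
  have h1 : (a + b)^2 ≤ 2 * |a|^2 + 2 * b^2 := by rw [sq_abs]; nlinarith [sq_nonneg (a - b)]
  have h2 : b^2 = |b|^2 := (sq_abs b).symm
  have ha := abs_nonneg a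
  have hb := abs_nonneg b
  have key : hub l (a+b) ≤ 2 * l * |a| + 2 * |b|^2 := by
    by_cases h : |a| ≤ l
    · have := hub_le_sq (l := l) (a+b); nlinarith
    · push Not at h
      have h3 := hub_le hl (a+b)
      by_cases h4 : l ≤ |b|
      · nlinarith
      · unfold hub; split_ifs with h5
        · rw [← sq_abs (a+b)]; nlinarith [abs_nonneg (a+b)]
        · nlinarith [sq_nonneg (|b| - l)]
  rw [h2]; exact key

lemma hub_ge {l : ℝ} (hl : 0 < l) (x : ℝ) : l / 4 * |x| - l ^ 2 / 64 ≤ hub l x := by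
  unfold hub; split_ifs with h
  · rw [← sq_abs x]; nlinarith [sq_nonneg (|x| - l/8)]
  · push Not at h; nlinarith

lemma hub_ge_of_lt {l : ℝ} (hl : 0 < l) {x : ℝ} (h : l < |x|) : l * |x| ≤ hub l x := by
  unfold hub; rw [if_neg (by linarith)]; nlinarith

lemma hub_eq_of_le {l : ℝ} {x : ℝ} (h : |x| ≤ l) : hub l x = x ^ 2 := by
  unfold hub; rw [if_pos h]

lemma hub_breg0 {l : ℝ} (hl : 0 < l) (a y : ℝ) : hub l a + hubD l a * y ≤ hub l (a + y) := by
  unfold hub hubD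
  rcases le_total a (-l) with h1 | h1
  · have e : max (-l) (min a l) = -l := by rw [min_eq_left (by linarith), max_eq_left h1]
    rw [e]
    rcases abs_cases a with ⟨h2, h3⟩ | ⟨h2, h3⟩ <;> rcases abs_cases (a+y) with ⟨h4, h5⟩ | ⟨h4, h5⟩ <;>
    rw [h2, h4] <;> split_ifs <;> nlinarith [sq_nonneg (a+y+l), sq_nonneg (a + l)]
  · rcases le_total l a with h2 | h2
    · have e : max (-l) (min a l) = l := by rw [min_eq_right h2, max_eq_right (by linarith)]
      rw [e]
      rcases abs_cases a with ⟨h2, h3⟩ | ⟨h2, h3⟩ <;> rcases abs_cases (a+y) with ⟨h4, h5⟩ | ⟨h4, h5⟩ <;>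
      rw [h2, h4] <;> split_ifs <;> nlinarith [sq_nonneg (a+y-l), sq_nonneg (a - l)]
    · have e : max (-l) (min a l) = a := by rw [min_eq_left h2, max_eq_right h1]
      rw [e, if_pos (abs_le.2 ⟨h1, h2⟩)]
      rcases abs_cases (a+y) with ⟨h4, h5⟩ | ⟨h4, h5⟩ <;> rw [h4] <;> split_ifs
      · nlinarith [sq_nonneg y]
      · nlinarith [mul_nonneg (sub_nonneg.2 h2) (show 0 ≤ a + y - l by linarith), sq_nonneg (a - l)]
      · nlinarith [sq_nonneg y]
      · nlinarith [mul_nonneg (show 0 ≤ a + l by linarith) (show 0 ≤ -(a + y) - l by linarith), sq_nonneg (a + l)]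

lemma hub_breg1 {l : ℝ} (hl : 0 < l) (a y : ℝ) (ha : |a| ≤ l / 2) :
    hub l a + hubD l a * y + hub l y / 4 ≤ hub l (a + y) := by
  have ha' := abs_le.1 ha
  have e : hubD l a = 2 * a := by
    unfold hubD; rw [min_eq_left (by linarith), max_eq_right (by linarith)]
  rw [e, hub_eq_of_le (show |a| ≤ l by linarith)]
  by_cases hy : |a + y| ≤ l
  · rw [hub_eq_of_le hy]; have := hub_le_sq (l := l) y; nlinarith
  · have h1 := hub_le hl y
    have h2 : hub l (a + y) = 2 * l * |a + y| - l ^ 2 := by unfold hub; rw [if_neg hy]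
    rw [h2]
    push Not at hy
    rcases abs_cases (a+y) with ⟨h4, h5⟩ | ⟨h4, h5⟩ <;> rw [h4] at hy ⊢
    · have h3 : |y| = y := abs_of_nonneg (by linarith)
      rw [h3] at h1
      nlinarith [mul_nonneg (show 0 ≤ 3/2*l - 2*a by linarith) (show 0 ≤ a + y - l by linarith), mul_nonneg (show 0 ≤ l/2 - a by linarith) (show 0 ≤ l - a by linarith)]
    · have h3 : |y| = -y := abs_of_nonpos (by linarith)
      rw [h3] at h1
      nlinarith [mul_nonneg (show 0 ≤ 3/2*l + 2*a by linarith) (show 0 ≤ -a - y - l by linarith), mul_nonneg (show 0 ≤ l/2 + a by linarith) (show 0 ≤ l + a by linarith)]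

lemma measurable_hub (l : ℝ) : Measurable (hub l) := by
  unfold hub
  exact Measurable.ite (measurableSet_le (by fun_prop) (by fun_prop)) (by fun_prop) (by fun_prop)

lemma measurable_hubD (l : ℝ) : Measurable (hubD l) := by
  unfold hubD; fun_prop

lemma abs_hubD_le {l : ℝ} (hl : 0 < l) (x : ℝ) : |hubD l x| ≤ 2 * l := by
  unfold hubD
  rw [abs_mul, abs_two]
  have : |max (-l) (min x l)| ≤ l := abs_le.2 ⟨le_max_left _ _, max_le (by linarith) (min_le_right _ _)⟩
  linarith

section prob
variable {X : Type*} [MeasurableSpace X] {P : Measure X} [IsProbabilityMeasure P]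

lemma integrable_hub {l : ℝ} (hl : 0 < l) {f : X → ℝ} (hf : Integrable f P) :
    Integrable (fun x => hub l (f x)) P := by
  refine Integrable.mono' (hf.abs.const_mul (2 * l)) ?_ ?_
  · exact ((measurable_hub l).comp_aemeasurable hf.aemeasurable).aestronglyMeasurable
  · filter_upwards with x
    rw [Real.norm_of_nonneg (hub_nonneg hl _)]; exact hub_le hl _

lemma hub_jensen {l : ℝ} (hl : 0 < l) {f : X → ℝ} (hf : Integrable f P) :
    hub l (∫ x, f x ∂P) ≤ ∫ x, hub l (f x) ∂P := by
  set a := ∫ x, f x ∂P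
  have h : ∫ x, (hub l a + hubD l a * (f x - a)) ∂P ≤ ∫ x, hub l (f x) ∂P := by
    refine integral_mono (by fun_prop) (integrable_hub hl hf) fun x => ?_
    have := hub_breg0 hl a (f x - a)
    simpa using this
  rw [integral_add (by fun_prop) (by fun_prop), integral_const_mul, integral_sub hf (by fun_prop)] at h
  simpa [a] using h

lemma hub_step {l : ℝ} (hl : 0 < l) {S Y : X → ℝ} (hS : Integrable S P) (hY : Integrable Y P)
    (hSm : Measurable S) (hYm : Measurable Y)
    (hi : IndepFun S Y P) (hY0 : ∫ x, Y x ∂P = 0) (hSl : ∫ x, |S x| ∂P ≤ l / 4) :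
    ∫ x, hub l (S x) ∂P + (∫ x, hub l (Y x) ∂P) / 8 ≤ ∫ x, hub l (S x + Y x) ∂P := by
  let E : Set ℝ := {a | |a| ≤ l/2}
  have hE : MeasurableSet E := measurableSet_le (by fun_prop) (by fun_prop)
  let ι : ℝ → ℝ := E.indicator (fun _ => 1)
  have hι : Measurable ι := measurable_const.indicator hE
  have hιb : ∀ a, ‖ι a‖ ≤ 1 := fun a => by
    by_cases h : a ∈ E <;> simp [ι, h]
  have hpt : ∀ x, hub l (S x) + hubD l (S x) * Y x + ι (S x) * (hub l (Y x) / 4) ≤ hub l (S x + Y x) := by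
    intro x
    by_cases h : S x ∈ E
    · simp only [ι, Set.indicator_of_mem h, one_mul]
      exact hub_breg1 hl _ _ h
    · simp only [ι, Set.indicator_of_notMem h, zero_mul, add_zero]
      exact hub_breg0 hl _ _
  have hhY := integrable_hub hl hY
  have i1 : Integrable (fun x => hubD l (S x) * Y x) P := by
    refine hY.bdd_mul (c := 2 * l) ((measurable_hubD l).comp hSm).aestronglyMeasurable ?_
    filter_upwards with x using abs_hubD_le hl _
  have i2 : Integrable (fun x => ι (S x) * (hub l (Y x) / 4)) P := by
    refine (hhY.div_const 4).bdd_mul (c := 1) (hι.comp hSm).aestronglyMeasurable ?_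
    filter_upwards with x using hιb _
  have h := integral_mono ((integrable_hub hl hS).add i1 |>.add i2) (integrable_hub hl (hS.add hY)) hpt
  have i12 : Integrable (fun x => hub l (S x) + hubD l (S x) * Y x) P := (integrable_hub hl hS).add i1
  have h : ∫ x, ((fun x => hub l (S x) + hubD l (S x) * Y x) x + ι (S x) * (hub l (Y x) / 4)) ∂P
    ≤ ∫ x, hub l (S x + Y x) ∂P := h
  rw [integral_add i12 i2, integral_add (integrable_hub hl hS) i1] at h
  have e1 : ∫ x, hubD l (S x) * Y x ∂P = 0 := by
    have := (hi.comp (measurable_hubD l) measurable_id).integral_fun_mul_eq_mul_integral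
      ((measurable_hubD l).comp hSm).aestronglyMeasurable hYm.aestronglyMeasurable
    simp only [Function.comp_apply, id] at this
    rw [this, hY0, mul_zero]
  have e2 : ∫ x, ι (S x) * (hub l (Y x) / 4) ∂P = (∫ x, ι (S x) ∂P) * ((∫ x, hub l (Y x) ∂P) / 4) := by
    have := (hi.comp hι ((measurable_hub l).div_const 4)).integral_fun_mul_eq_mul_integral
      (hι.comp hSm).aestronglyMeasurable (((measurable_hub l).div_const 4).comp hYm).aestronglyMeasurable
    simp only [Function.comp_apply] at this
    rw [this, integral_div]
  have e3 : 1/2 ≤ ∫ x, ι (S x) ∂P := by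
    have : ∫ x, (1 - 2 / l * |S x|) ∂P ≤ ∫ x, ι (S x) ∂P := by
      refine integral_mono (by have := hS.abs; fun_prop) ?_ ?_
      · exact Integrable.of_bound (hι.comp hSm).aestronglyMeasurable 1 (by filter_upwards with x using hιb _)
      · intro x
        by_cases h : S x ∈ E
        · simp only [ι, Set.indicator_of_mem h]
          have : 0 ≤ 2 / l * |S x| := by positivity
          linarith
        · simp only [ι, Set.indicator_of_notMem h]
          have h : l / 2 < |S x| := not_le.1 h
          rw [sub_nonpos, div_mul_eq_mul_div, le_div_iff₀ hl]; linarith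
    rw [integral_sub (by fun_prop) (hS.abs.const_mul _), integral_const_mul] at this
    have h3 : 2 / l * ∫ x, |S x| ∂P ≤ 2 / l * (l / 4) := by gcongr
    have h4 : 2 / l * (l/4) = 1/2 := by field_simp; norm_num
    simp at this
    linarith
  have e4 : 0 ≤ ∫ x, hub l (Y x) ∂P := integral_nonneg fun x => hub_nonneg hl _
  rw [e1, e2] at h
  nlinarith

end prob

end Part1

section Part2

/-- The infinite product measure. -/
noncomputable abbrev pim (μ : Measure Ω) [IsProbabilityMeasure μ] : Measure (ℕ → Ω) :=
  Measure.infinitePi (fun _ : ℕ => μ)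

lemma pi_unique (μ : Measure Ω) [IsProbabilityMeasure μ] (π : Measure (ℕ → Ω))
    (h : ∀ n : ℕ, Measure.map (fun x : ℕ → Ω => fun k : Fin n => x k) π
            = Measure.pi fun _ : Fin n => μ) : π = pim μ := by
  refine Measure.eq_infinitePi _ fun s t ht => ?_
  obtain ⟨n, hn⟩ : ∃ n, s ⊆ Finset.range n := ⟨s.sup id + 1, fun i hi => by
    have := Finset.le_sup (f := id) hi
    simp at this ⊢; omega⟩
  classical
  let t' : ℕ → Set Ω := fun i => if i ∈ s then t i else Set.univ
  have ht' : ∀ i, MeasurableSet (t' i) := fun i => by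
    by_cases hi : i ∈ s <;> simp [t', hi, ht]
  have e : Set.pi (s : Set ℕ) t = (fun x : ℕ → Ω => fun k : Fin n => x k) ⁻¹' (Set.pi Set.univ fun k : Fin n => t' k) := by
    ext x
    simp only [Set.mem_pi, Set.mem_preimage, Finset.mem_coe, Set.mem_univ, true_implies]
    constructor
    · intro hx k
      by_cases hk : (k : ℕ) ∈ s
      · simpa [t', hk] using hx _ hk
      · simp [t', hk]
    · intro hx i hi
      have := hx ⟨i, Finset.mem_range.1 (hn hi)⟩
      simpa [t', hi] using this
  rw [e, ← Measure.map_apply (by fun_prop) (MeasurableSet.univ_pi fun k : Fin n => ht' (k : ℕ)), h n, Measure.pi_pi,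
    Fin.prod_univ_eq_prod_range (fun i => μ (t' i)) n, ← Finset.prod_subset hn]
  · exact Finset.prod_congr rfl fun i hi => by simp [t', hi]
  · intro i _ hi; simp [t', hi]

variable {μ : Measure Ω} [IsProbabilityMeasure μ]

lemma measurable_pw (A : Finset ℕ) :
    Measurable (fun p : (ℕ → Ω) × (ℕ → Ω) => A.piecewise p.1 p.2) := by
  refine measurable_pi_lambda _ fun i => ?_
  by_cases hi : i ∈ A
  · simp only [Finset.piecewise_eq_of_mem _ _ _ hi]; fun_prop
  · simp only [Finset.piecewise_eq_of_notMem _ _ _ hi]; fun_prop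

lemma mp_pw (A : Finset ℕ) :
    MeasurePreserving (fun p : (ℕ → Ω) × (ℕ → Ω) => A.piecewise p.1 p.2)
      ((pim μ).prod (pim μ)) (pim μ) := by
  refine ⟨measurable_pw A, ?_⟩
  refine Measure.eq_infinitePi _ fun s t ht => ?_
  rw [Measure.map_apply (measurable_pw A) (MeasurableSet.pi s.countable_toSet fun i _ => ht i)]
  have e : (fun p : (ℕ → Ω) × (ℕ → Ω) => A.piecewise p.1 p.2) ⁻¹' (Set.pi (s : Set ℕ) t)
    = (Set.pi ((s ∩ A : Finset ℕ) : Set ℕ) t) ×ˢ (Set.pi ((s \ A : Finset ℕ) : Set ℕ) t) := by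
    ext p
    simp only [Set.mem_preimage, Set.mem_pi, Finset.mem_coe, Set.mem_prod, Finset.mem_inter, Finset.mem_sdiff]
    constructor
    · intro h
      refine ⟨fun i hi => ?_, fun i hi => ?_⟩
      · simpa [hi.2] using h i hi.1
      · simpa [hi.2] using h i hi.1
    · rintro ⟨h1, h2⟩ i hi
      by_cases hA : i ∈ A
      · simpa [hA] using h1 i ⟨hi, hA⟩
      · simpa [hA] using h2 i ⟨hi, hA⟩
  rw [e, Measure.prod_prod, Measure.infinitePi_pi _ (fun i _ => ht i), Measure.infinitePi_pi _ (fun i _ => ht i)]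
  exact Finset.prod_inter_mul_prod_sdiff _ _ _

lemma mp_eval (i : ℕ) : MeasurePreserving (fun x : ℕ → Ω => x i) (pim μ) μ :=
  measurePreserving_eval_infinitePi _ i

lemma integral_eval (i : ℕ) {g : Ω → ℝ} (hg : Measurable g) : ∫ x, g (x i) ∂(pim μ) = ∫ w, g w ∂μ := by
  conv_rhs => rw [← (mp_eval (μ := μ) i).map_eq]
  rw [integral_map (measurable_pi_apply i).aemeasurable hg.aestronglyMeasurable]

lemma integrable_eval (i : ℕ) {g : Ω → ℝ} (hg : Integrable g μ) : Integrable (fun x : ℕ → Ω => g (x i)) (pim μ) :=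
  (mp_eval (μ := μ) i).integrable_comp_of_integrable hg

lemma indep (f : ℕ → Ω → ℝ) (hf : ∀ i, Measurable (f i)) :
    iIndepFun (fun i (x : ℕ → Ω) => f i (x i)) (pim μ) := by
  exact iIndepFun_infinitePi (P := fun _ : ℕ => μ) (X := fun i w => f i w) (fun i => (hf i))

lemma core {l : ℝ} (hl : 0 < l) (f : ℕ → Ω → ℝ) (hf : ∀ i, Measurable (f i))
    (hfi : ∀ i, Integrable (f i) μ) (h0 : ∀ i, ∫ w, f i w ∂μ = 0) (n : ℕ)
    (h : ∀ k < n, ∫ x, |∑ i ∈ Finset.range k, f i (x i)| ∂(pim μ) ≤ l / 4) :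
    ∑ i ∈ Finset.range n, ∫ w, hub l (f i w) ∂μ
      ≤ 8 * ∫ x, hub l (∑ i ∈ Finset.range n, f i (x i)) ∂(pim μ) := by
  induction n with
  | zero => simp [hub, hl.le]
  | succ n ih =>
    have ih := ih fun k hk => h k (by omega)
    have hi : IndepFun (fun x : ℕ → Ω => ∑ i ∈ Finset.range n, f i (x i)) (fun x => f n (x n)) (pim μ) := by
      have := (indep (μ := μ) f hf).indepFun_finsetSum_of_notMem (fun i => by have := hf i; fun_prop)
        (s := Finset.range n) (i := n) (by simp)
      convert this using 1
      ext x; simp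
    have st := hub_step hl (integrable_finsetSum _ fun i _ => integrable_eval i (hfi i))
      (integrable_eval n (hfi n)) (by fun_prop) (by have := hf n; fun_prop) hi
      (by rw [integral_eval n (hf n), h0 n]) (h n (by omega))
    have e := integral_eval (μ := μ) n ((measurable_hub l).comp (hf n))
    simp only [Function.comp_apply] at e
    rw [e] at st
    simp only [Finset.sum_range_succ]
    linarith

/-- partial averaging -/
noncomputable def cav0 (μ : Measure Ω) [IsProbabilityMeasure μ] (A : Finset ℕ) (w : (ℕ → Ω) → ℝ) (x : ℕ → Ω) : ℝ :=
  ∫ y, w (A.piecewise x y) ∂(pim μ)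

lemma integrable_pw (A : Finset ℕ) {w : (ℕ → Ω) → ℝ} (hw : Integrable w (pim μ)) :
    Integrable (fun p : (ℕ → Ω) × (ℕ → Ω) => w (A.piecewise p.1 p.2)) ((pim μ).prod (pim μ)) :=
  (mp_pw (μ := μ) A).integrable_comp_of_integrable hw

lemma cav0_ae (A : Finset ℕ) {w : (ℕ → Ω) → ℝ} (hw : Integrable w (pim μ)) :
    ∀ᵐ x ∂(pim μ), Integrable (fun y => w (A.piecewise x y)) (pim μ) :=
  (integrable_pw A hw).prod_right_ae

lemma integral_pw (A : Finset ℕ) {w : (ℕ → Ω) → ℝ} (hw : Integrable w (pim μ)) :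
    ∫ x, ∫ y, w (A.piecewise x y) ∂(pim μ) ∂(pim μ) = ∫ x, w x ∂(pim μ) := by
  rw [integral_integral (integrable_pw A hw)]
  conv_rhs => rw [← (mp_pw (μ := μ) A).map_eq]
  rw [integral_map (measurable_pw A).aemeasurable]
  rw [(mp_pw (μ := μ) A).map_eq]; exact hw.aestronglyMeasurable

lemma integrable_cav0 (A : Finset ℕ) {w : (ℕ → Ω) → ℝ} (hw : Integrable w (pim μ)) :
    Integrable (cav0 μ A w) (pim μ) := (integrable_pw A hw).integral_prod_left

lemma integral_cav0 (A : Finset ℕ) {w : (ℕ → Ω) → ℝ} (hw : Integrable w (pim μ)) :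
    ∫ x, cav0 μ A w x ∂(pim μ) = ∫ x, w x ∂(pim μ) := integral_pw A hw

lemma cav0_abs (A : Finset ℕ) {w : (ℕ → Ω) → ℝ} (hw : Integrable w (pim μ)) :
    ∫ x, |cav0 μ A w x| ∂(pim μ) ≤ ∫ x, |w x| ∂(pim μ) := by
  rw [← integral_pw A hw.abs]
  refine integral_mono (integrable_cav0 A hw).abs (integrable_cav0 A hw.abs) fun x => ?_
  exact abs_integral_le_integral_abs

lemma cav0_hub {l : ℝ} (hl : 0 < l) (A : Finset ℕ) {w : (ℕ → Ω) → ℝ} (hw : Integrable w (pim μ)) :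
    ∫ x, hub l (cav0 μ A w x) ∂(pim μ) ≤ ∫ x, hub l (w x) ∂(pim μ) := by
  rw [← integral_pw A (integrable_hub hl hw)]
  refine integral_mono_ae (integrable_hub hl (integrable_cav0 A hw)) (integrable_cav0 A (integrable_hub hl hw)) ?_
  filter_upwards [cav0_ae A hw] with x hx
  exact hub_jensen hl hx

lemma cav0_add (A : Finset ℕ) {w h : (ℕ → Ω) → ℝ} (hw : Integrable w (pim μ)) (hh : Integrable h (pim μ)) :
    ∀ᵐ x ∂(pim μ), cav0 μ A (fun x => w x + h x) x = cav0 μ A w x + cav0 μ A h x := by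
  filter_upwards [cav0_ae A hw, cav0_ae A hh] with x h1 h2
  exact integral_add h1 h2

lemma cav0_sub (A : Finset ℕ) {w h : (ℕ → Ω) → ℝ} (hw : Integrable w (pim μ)) (hh : Integrable h (pim μ)) :
    ∀ᵐ x ∂(pim μ), cav0 μ A (fun x => w x - h x) x = cav0 μ A w x - cav0 μ A h x := by
  filter_upwards [cav0_ae A hw, cav0_ae A hh] with x h1 h2
  exact integral_sub h1 h2

lemma cav0_sum (A : Finset ℕ) (n : ℕ) (g : ℕ → Ω → ℝ) (hg : ∀ i, Measurable (g i))
    (hgi : ∀ i, Integrable (g i) μ) (h0 : ∀ i, ∫ w, g i w ∂μ = 0) (x : ℕ → Ω) :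
    cav0 μ A (fun x => ∑ i ∈ Finset.range n, g i (x i)) x
      = ∑ i ∈ A, if i < n then g i (x i) else 0 := by
  unfold cav0
  rw [integral_finsetSum]
  · have e : ∀ i, ∫ y, g i (A.piecewise x y i) ∂(pim μ) = if i ∈ A then g i (x i) else 0 := by
      intro i
      by_cases hi : i ∈ A
      · simp [hi]
      · simp only [Finset.piecewise_eq_of_notMem _ _ _ hi, hi, if_false]
        rw [integral_eval i (hg i), h0]
    simp only [e]
    rw [← Finset.sum_filter, ← Finset.sum_filter]
    refine Finset.sum_congr ?_ fun _ _ => rfl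
    ext i; simp [and_comm]
  · intro i _
    by_cases hi : i ∈ A
    · simp only [Finset.piecewise_eq_of_mem _ _ _ hi]; fun_prop
    · simp only [Finset.piecewise_eq_of_notMem _ _ _ hi]
      exact integrable_eval i (hgi i)

lemma cav0_single (i : ℕ) (w : (ℕ → Ω) → ℝ) (x : ℕ → Ω) :
    cav0 μ {i} w x = cav0 μ {i} w (fun _ => x i) := by
  unfold cav0
  congr 1; ext y; congr 1; ext j
  by_cases hj : j = i
  · subst hj; simp
  · simp [Finset.piecewise, hj]

lemma cav0_lintegral {p : ℝ} (hp : 1 ≤ p) (A : Finset ℕ) {w : (ℕ → Ω) → ℝ} (hw : Measurable w) :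
    ∫⁻ x, ‖cav0 μ A w x‖ₑ ^ p ∂(pim μ) ≤ ∫⁻ x, ‖w x‖ₑ ^ p ∂(pim μ) := by
  have hm : Measurable (fun p : (ℕ → Ω) × (ℕ → Ω) => w (A.piecewise p.1 p.2)) := hw.comp (measurable_pw A)
  calc _ ≤ ∫⁻ x, ∫⁻ y, ‖w (A.piecewise x y)‖ₑ ^ p ∂(pim μ) ∂(pim μ) := by
        refine lintegral_mono fun x => ?_
        have hx : Measurable (fun y => w (A.piecewise x y)) := hm.comp measurable_prodMk_left
        have h1 : ‖cav0 μ A w x‖ₑ ≤ eLpNorm (fun y => w (A.piecewise x y)) 1 (pim μ) := by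
          rw [eLpNorm_one_eq_lintegral_enorm]; exact enorm_integral_le_lintegral_enorm _
        have h2 := eLpNorm_le_eLpNorm_of_exponent_le (p := 1) (q := ENNReal.ofReal p)
          (by simpa using hp) hx.aestronglyMeasurable (μ := pim μ)
        have h3 := h1.trans h2
        rw [eLpNorm_eq_lintegral_rpow_enorm_toReal (by simp; linarith) (by simp), ENNReal.toReal_ofReal (by linarith)] at h3
        have := ENNReal.rpow_le_rpow h3 (show 0 ≤ p by linarith)
        rwa [← ENNReal.rpow_mul, one_div, inv_mul_cancel₀ (by linarith), ENNReal.rpow_one] at this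
    _ = ∫⁻ x, ‖w x‖ₑ ^ p ∂(pim μ) := by
        have hq : Measurable (fun x => ‖w x‖ₑ ^ p) := hw.enorm.pow_const p
        conv_rhs => rw [← (mp_pw (μ := μ) A).map_eq]
        rw [lintegral_map hq (measurable_pw A)]
        exact (lintegral_prod _ (hq.comp (measurable_pw A)).aemeasurable).symm

end Part2

section Part3

/-- The measure on pairs. -/
noncomputable abbrev PP (μ : Measure Ω) [IsProbabilityMeasure μ] : Measure ((ℕ → Ω) × ℝ) :=
  (pim μ).prod volume

/-- Partial averaging of functions on pairs. -/
noncomputable def Cav (μ : Measure Ω) [IsProbabilityMeasure μ] (A : Finset ℕ) (w : (ℕ → Ω) × ℝ → ℝ)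
    (z : (ℕ → Ω) × ℝ) : ℝ := cav0 μ A (fun x => w (x, z.2)) z.1

variable {μ : Measure Ω} [IsProbabilityMeasure μ]

lemma measurable_Cav (A : Finset ℕ) {w : (ℕ → Ω) × ℝ → ℝ} (hw : Measurable w) :
    Measurable (Cav μ A w) := by
  unfold Cav cav0
  have : Measurable (fun q : ((ℕ → Ω) × ℝ) × (ℕ → Ω) => w (A.piecewise q.1.1 q.2, q.1.2)) :=
    hw.comp (((measurable_pw A).comp (by fun_prop : Measurable (fun q : ((ℕ → Ω) × ℝ) × (ℕ → Ω) => (q.1.1, q.2)))).prodMk (by fun_prop))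
  exact (this.stronglyMeasurable.integral_prod_right).measurable

lemma ae_of_ae_ae {p : (ℕ → Ω) × ℝ → Prop} (hp : MeasurableSet {z | p z})
    (h : ∀ᵐ s ∂(volume : Measure ℝ), ∀ᵐ x ∂(pim μ), p (x, s)) : ∀ᵐ z ∂(PP μ), p z := by
  have h1 : ∀ᵐ q ∂((volume : Measure ℝ).prod (pim μ)), p q.swap :=
    (Measure.ae_prod_iff_ae_ae (p := fun q : ℝ × (ℕ → Ω) => p q.swap) (measurable_swap hp)).2 h
  have h2 := (Measure.measurePreserving_swap (μ := pim μ) (ν := (volume : Measure ℝ))).quasiMeasurePreserving.ae h1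
  simpa using h2

lemma ae_ae_of_ae {p : (ℕ → Ω) × ℝ → Prop} (h : ∀ᵐ z ∂(PP μ), p z) :
    ∀ᵐ s ∂(volume : Measure ℝ), ∀ᵐ x ∂(pim μ), p (x, s) := by
  have h2 := (Measure.measurePreserving_swap (μ := (volume : Measure ℝ)) (ν := pim μ)).quasiMeasurePreserving.ae h
  exact Measure.ae_ae_of_ae_prod h2

lemma eLpNorm_PP {p : ℝ≥0∞} (h1 : 1 ≤ p) (ht : p ≠ ⊤) {w : (ℕ → Ω) × ℝ → ℝ} (hw : Measurable w) :
    eLpNorm w p (PP μ) = (∫⁻ s, ∫⁻ x, ‖w (x, s)‖ₑ ^ p.toReal ∂(pim μ)) ^ (1 / p.toReal) := by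
  rw [eLpNorm_eq_lintegral_rpow_enorm_toReal (by positivity) ht]
  rw [lintegral_prod_symm _ (by fun_prop)]

lemma Cav_norm {p : ℝ≥0∞} (h1 : 1 ≤ p) (ht : p ≠ ⊤) (A : Finset ℕ) {w : (ℕ → Ω) × ℝ → ℝ} (hw : Measurable w) :
    eLpNorm (Cav μ A w) p (PP μ) ≤ eLpNorm w p (PP μ) := by
  rw [eLpNorm_PP h1 ht hw, eLpNorm_PP h1 ht (measurable_Cav A hw)]
  refine ENNReal.rpow_le_rpow ?_ (by positivity)
  refine lintegral_mono fun s => ?_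
  exact cav0_lintegral (by simpa using ENNReal.toReal_mono ht h1) A (hw.comp measurable_prodMk_right)

lemma slice_integrable {p : ℝ≥0∞} (h1 : 1 ≤ p) (ht : p ≠ ⊤) {w : (ℕ → Ω) × ℝ → ℝ} (hw : Measurable w)
    (hf : eLpNorm w p (PP μ) < ⊤) :
    ∀ᵐ s ∂(volume : Measure ℝ), Integrable (fun x => w (x, s)) (pim μ) := by
  rw [eLpNorm_PP h1 ht hw] at hf
  have hp : 0 < p.toReal := ENNReal.toReal_pos (by positivity) ht
  have h2 : ∫⁻ s, ∫⁻ x, ‖w (x, s)‖ₑ ^ p.toReal ∂(pim μ) ≠ ⊤ := by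
    intro h; rw [h, ENNReal.top_rpow_of_pos (by positivity)] at hf; exact lt_irrefl _ hf
  have h3 := ae_lt_top (Measurable.lintegral_prod_left' (f := fun z : (ℕ → Ω) × ℝ => ‖w z‖ₑ ^ p.toReal) (by fun_prop)) h2
  filter_upwards [h3] with s hs
  have hm : MemLp (fun x => w (x, s)) p (pim μ) := by
    refine ⟨(hw.comp measurable_prodMk_right).aestronglyMeasurable, ?_⟩
    rw [eLpNorm_eq_lintegral_rpow_enorm_toReal (by positivity) ht]
    exact ENNReal.rpow_lt_top_of_nonneg (by positivity) hs.ne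
  exact hm.integrable h1

/-- uncurried version of membership in V -/
def MemV (μ : Measure Ω) [IsProbabilityMeasure μ] (p : ℝ≥0∞) (w : (ℕ → Ω) × ℝ → ℝ) : Prop :=
  Measurable w ∧ eLpNorm w p (PP μ) < ⊤ ∧
  ∀ ε : ℝ, 0 < ε → ∃ (n : ℕ) (g : ℕ → Ω × ℝ → ℝ),
    (∀ i, Measurable (g i)) ∧
    (∀ i, ∀ᵐ s ∂(volume : Measure ℝ),
      Integrable (fun ω => g i (ω, s)) μ ∧ ∫ ω, g i (ω, s) ∂μ = 0) ∧
    (∀ i, eLpNorm (fun z : (ℕ → Ω) × ℝ => g i (z.1 i, z.2)) p (PP μ) < ⊤) ∧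
    eLpNorm (fun z => w z - ∑ i ∈ Finset.range n, g i (z.1 i, z.2)) p (PP μ) ≤ ENNReal.ofReal ε

lemma nrm1_eq {F : (ℕ → Ω) → ℝ → ℝ} (hF : Measurable (Function.uncurry F)) :
    nrmL1L1 (pim μ) F = eLpNorm (Function.uncurry F) 1 (PP μ) := by
  rw [eLpNorm_one_eq_lintegral_enorm, lintegral_prod _ (by fun_prop)]
  simp [nrmL1L1, Real.enorm_eq_ofReal_abs]

lemma nrm2_eq {F : (ℕ → Ω) → ℝ → ℝ} (hF : Measurable (Function.uncurry F)) :
    nrmL2L2 (pim μ) F = eLpNorm (Function.uncurry F) 2 (PP μ) := by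
  rw [eLpNorm_eq_lintegral_rpow_enorm_toReal (by simp) (by simp), lintegral_prod _ (by fun_prop)]
  simp only [nrmL2L2, Real.enorm_eq_ofReal_abs, ENNReal.toReal_ofNat, ENNReal.rpow_ofNat, Function.uncurry]
  simp only [← ENNReal.ofReal_pow (abs_nonneg _), sq_abs]

lemma memV_of {p : ℝ≥0∞} {N : ((ℕ → Ω) → ℝ → ℝ) → ℝ≥0∞}
    (hN : ∀ F, Measurable (Function.uncurry F) → N F = eLpNorm (Function.uncurry F) p (PP μ))
    {F : (ℕ → Ω) → ℝ → ℝ} (h : MemV1inf μ N F) : MemV μ p (Function.uncurry F) := by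
  obtain ⟨hm, hf, ha⟩ := h
  refine ⟨hm, by rwa [← hN F hm], fun ε hε => ?_⟩
  obtain ⟨n, g, g1, g2, g3, g4⟩ := ha ε hε
  have hgm : ∀ i, Measurable (fun z : (ℕ → Ω) × ℝ => Function.uncurry (g i) (z.1 i, z.2)) := fun i =>
    (g1 i).comp (by fun_prop)
  refine ⟨n, fun i => Function.uncurry (g i), g1, g2, fun i => ?_, ?_⟩
  · have := g3 i
    rwa [hN _ (hgm i)] at this
  · have hN' : ∀ w, Measurable w → N (fun x s => w (x, s)) = eLpNorm w p (PP μ) :=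
      fun w hw => hN (fun x s => w (x, s)) hw
    have := hN' (fun z => F z.1 z.2 - ∑ i ∈ Finset.range n, g i (z.1 i) z.2)
      (hm.sub (Finset.measurable_sum _ fun i _ => hgm i))
    rw [this] at g4; exact g4

lemma memV_to {p : ℝ≥0∞} {N : ((ℕ → Ω) → ℝ → ℝ) → ℝ≥0∞}
    (hN : ∀ F, Measurable (Function.uncurry F) → N F = eLpNorm (Function.uncurry F) p (PP μ))
    {w : (ℕ → Ω) × ℝ → ℝ} (h : MemV μ p w) : MemV1inf μ N (fun x s => w (x, s)) := by
  obtain ⟨hm, hf, ha⟩ := h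
  have hN' : ∀ w, Measurable w → N (fun x s => w (x, s)) = eLpNorm w p (PP μ) :=
    fun w hw => hN (fun x s => w (x, s)) hw
  refine ⟨hm, by rw [hN' _ hm]; exact hf, fun ε hε => ?_⟩
  obtain ⟨n, g, g1, g2, g3, g4⟩ := ha ε hε
  have hgm : ∀ i, Measurable (fun z : (ℕ → Ω) × ℝ => (g i) (z.1 i, z.2)) := fun i =>
    (g1 i).comp (by fun_prop)
  refine ⟨n, fun i ω s => g i (ω, s), g1, g2, fun i => ?_, ?_⟩
  · exact (hN' _ (hgm i)).trans_lt (g3 i)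
  · exact (hN' (fun z => w z - ∑ i ∈ Finset.range n, g i (z.1 i, z.2))
      (hm.sub (Finset.measurable_sum _ fun i _ => hgm i))).trans_le g4

lemma Cav_sub {p : ℝ≥0∞} (h1 : 1 ≤ p) (ht : p ≠ ⊤) (A : Finset ℕ) {w h : (ℕ → Ω) × ℝ → ℝ} (hw : Measurable w)
    (hh : Measurable h) (hwf : eLpNorm w p (PP μ) < ⊤) (hhf : eLpNorm h p (PP μ) < ⊤) :
    ∀ᵐ z ∂(PP μ), Cav μ A (fun z => w z - h z) z = Cav μ A w z - Cav μ A h z := by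
  refine ae_of_ae_ae (measurableSet_eq_fun (measurable_Cav A (hw.sub hh)) ((measurable_Cav A hw).sub (measurable_Cav A hh))) ?_
  filter_upwards [slice_integrable h1 ht hw hwf, slice_integrable h1 ht hh hhf] with s hs1 hs2
  exact cav0_sub A hs1 hs2

lemma Cav_fin {n : ℕ} {g : ℕ → Ω × ℝ → ℝ} (g1 : ∀ i, Measurable (g i))
    (g2 : ∀ i, ∀ᵐ s ∂(volume : Measure ℝ),
      Integrable (fun ω => g i (ω, s)) μ ∧ ∫ ω, g i (ω, s) ∂μ = 0) (A : Finset ℕ) :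
    ∀ᵐ z ∂(PP μ), Cav μ A (fun z => ∑ i ∈ Finset.range n, g i (z.1 i, z.2)) z
      = ∑ i ∈ A, if i < n then g i (z.1 i, z.2) else 0 := by
  have hgm : ∀ i, Measurable (fun z : (ℕ → Ω) × ℝ => (g i) (z.1 i, z.2)) := fun i =>
    (g1 i).comp (by fun_prop)
  refine ae_of_ae_ae (measurableSet_eq_fun (measurable_Cav A (Finset.measurable_sum _ fun i _ => hgm i))
    (Finset.measurable_sum _ fun i _ => ?_)) ?_
  · by_cases hi : i < n
    · simpa [hi] using hgm i
    · simp [hi]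
  · filter_upwards [ae_all_iff.2 g2] with s hs
    filter_upwards with x
    exact cav0_sum A n (fun i ω => g i (ω, s)) (fun i => (g1 i).comp measurable_prodMk_right)
      (fun i => (hs i).1) (fun i => (hs i).2) x

lemma MemV.approx {p : ℝ≥0∞} (h1 : 1 ≤ p) (ht : p ≠ ⊤) {w : (ℕ → Ω) × ℝ → ℝ} (h : MemV μ p w) {ε : ℝ} (hε : 0 < ε) :
    ∃ (d : (ℕ → Ω) × ℝ → ℝ) (n : ℕ), Measurable d ∧ eLpNorm d p (PP μ) ≤ ENNReal.ofReal ε ∧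
      (∀ A, ∀ᵐ z ∂(PP μ), Cav μ A w z - ∑ i ∈ A, Cav μ {i} w z = Cav μ A d z - ∑ i ∈ A, Cav μ {i} d z) ∧
      (∀ k, n ≤ k → ∀ᵐ z ∂(PP μ), Cav μ (Finset.range k) w z - w z = Cav μ (Finset.range k) d z - d z) := by
  obtain ⟨hm, hf, ha⟩ := h
  obtain ⟨n, g, g1, g2, g3, g4⟩ := ha ε hε
  have hgm : ∀ i, Measurable (fun z : (ℕ → Ω) × ℝ => (g i) (z.1 i, z.2)) := fun i =>
    (g1 i).comp (by fun_prop)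
  set q : (ℕ → Ω) × ℝ → ℝ := fun z => ∑ i ∈ Finset.range n, g i (z.1 i, z.2) with hq
  have hqm : Measurable q := Finset.measurable_sum _ fun i _ => hgm i
  have hqf : eLpNorm q p (PP μ) < ⊤ := by
    have : MemLp q p (PP μ) := memLp_finsetSum _ fun i _ => ⟨(hgm i).aestronglyMeasurable, g3 i⟩
    exact this.2
  have hs : ∀ A, ∀ᵐ z ∂(PP μ), Cav μ A (fun z => w z - q z) z = Cav μ A w z - Cav μ A q z :=
    fun A => Cav_sub h1 ht A hm hqm hf hqf
  have hc : ∀ A, ∀ᵐ z ∂(PP μ), Cav μ A q z = ∑ i ∈ A, if i < n then g i (z.1 i, z.2) else 0 :=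
    fun A => Cav_fin (μ := μ) (n := n) g1 g2 A
  refine ⟨fun z => w z - q z, n, hm.sub hqm, g4, fun A => ?_, fun k hk => ?_⟩
  · filter_upwards [hs A, ae_all_iff.2 (fun i : ℕ => hs {i}), hc A, ae_all_iff.2 (fun i : ℕ => hc {i})] with z a1 a2 a3 a4
    rw [a1, Finset.sum_congr rfl (fun i _ => a2 i), Finset.sum_sub_distrib, a3,
      Finset.sum_congr rfl (fun i _ => a4 i)]
    simp
  · filter_upwards [hs (Finset.range k), hc (Finset.range k)] with z a1 a3
    rw [a1, a3, ← Finset.sum_filter]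
    have : (Finset.range k).filter (fun i => i < n) = Finset.range n := by
      ext i; simp; omega
    rw [this]; simp only [hq]; ring

lemma MemV.sum_eq {p : ℝ≥0∞} (h1 : 1 ≤ p) (ht : p ≠ ⊤) {w : (ℕ → Ω) × ℝ → ℝ} (h : MemV μ p w) (A : Finset ℕ) :
    ∀ᵐ z ∂(PP μ), Cav μ A w z = ∑ i ∈ A, Cav μ {i} w z := by
  have hm := h.1
  have hD : Measurable (fun z => Cav μ A w z - ∑ i ∈ A, Cav μ {i} w z) :=
    (measurable_Cav A hm).sub (Finset.measurable_sum _ fun i _ => measurable_Cav _ hm)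
  have hb : ∀ ε : ℝ, 0 < ε → eLpNorm (fun z => Cav μ A w z - ∑ i ∈ A, Cav μ {i} w z) p (PP μ)
      ≤ (1 + A.card) * ENNReal.ofReal ε := by
    intro ε hε
    obtain ⟨d, n, hd, hde, hA, -⟩ := h.approx h1 ht hε
    rw [eLpNorm_congr_ae (hA A)]
    have hs := eLpNorm_sum_le (μ := PP μ) (p := p) (s := A) (f := fun i => Cav μ {i} d)
      (fun i _ => (measurable_Cav {i} hd).aestronglyMeasurable) h1
    have e : (fun z => Cav μ A d z - ∑ i ∈ A, Cav μ {i} d z) = Cav μ A d - ∑ i ∈ A, Cav μ {i} d := by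
      ext z; simp
    rw [e]
    refine (eLpNorm_sub_le (measurable_Cav A hd).aestronglyMeasurable
      (Finset.aestronglyMeasurable_sum _ fun i _ => (measurable_Cav {i} hd).aestronglyMeasurable) h1).trans ?_
    rw [add_mul, one_mul]
    refine add_le_add ((Cav_norm h1 ht A hd).trans hde) (hs.trans ?_)
    refine (Finset.sum_le_sum fun i _ => (Cav_norm h1 ht {i} hd).trans hde).trans ?_
    simp
  have h0 : eLpNorm (fun z => Cav μ A w z - ∑ i ∈ A, Cav μ {i} w z) p (PP μ) = 0 := by
    refine le_antisymm (ENNReal.le_of_forall_pos_le_add fun ε hε _ => ?_) bot_le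
    refine (hb (ε / (1 + A.card)) (by positivity)).trans ?_
    have : (1 + (A.card : ℝ≥0∞)) = ENNReal.ofReal (1 + A.card) := by
      rw [ENNReal.ofReal_add (by simp) (by simp)]; simp
    rw [this, ← ENNReal.ofReal_mul (by positivity), mul_div_cancel₀ _ (by positivity)]
    simp
  rw [eLpNorm_eq_zero_iff hD.aestronglyMeasurable (by positivity)] at h0
  filter_upwards [h0] with z hz
  simpa [sub_eq_zero] using hz

lemma MemV.tendsto {p : ℝ≥0∞} (h1 : 1 ≤ p) (ht : p ≠ ⊤) {w : (ℕ → Ω) × ℝ → ℝ} (h : MemV μ p w) :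
    Tendsto (fun n => eLpNorm (fun z => Cav μ (Finset.range n) w z - w z) p (PP μ)) atTop (𝓝 0) := by
  rw [ENNReal.tendsto_atTop_zero]
  intro ε hε
  obtain ⟨δ, hδ, hδε⟩ : ∃ δ : ℝ, 0 < δ ∧ ENNReal.ofReal δ + ENNReal.ofReal δ ≤ ε := by
    by_cases he : ε = ⊤
    · exact ⟨1, one_pos, by simp [he]⟩
    · refine ⟨ε.toReal / 2, half_pos (ENNReal.toReal_pos hε.ne' he), ?_⟩
      rw [← ENNReal.ofReal_add (by positivity) (by positivity), add_halves, ENNReal.ofReal_toReal he]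
  obtain ⟨d, n, hd, hde, -, hk⟩ := h.approx h1 ht hδ
  refine ⟨n, fun k hnk => ?_⟩
  rw [eLpNorm_congr_ae (hk k hnk)]
  refine (eLpNorm_sub_le (measurable_Cav _ hd).aestronglyMeasurable hd.aestronglyMeasurable h1).trans ?_
  exact (add_le_add ((Cav_norm h1 ht _ hd).trans hde) hde).trans hδε

end Part3

section Part4

variable {μ : Measure Ω} [IsProbabilityMeasure μ]

lemma ortho {l : ℝ} (r : ℕ → Ω → ℝ) (hr : ∀ i, Measurable (r i)) (hb : ∀ i w, |r i w| ≤ l) (I : Finset ℕ) :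
    ∫⁻ x, ‖∑ i ∈ I, (r i (x i) - ∫ w, r i w ∂μ)‖ₑ ^ 2 ∂(pim μ) ≤ ∑ i ∈ I, ∫⁻ w, ‖r i w‖ₑ ^ 2 ∂μ := by
  let X : ℕ → (ℕ → Ω) → ℝ := fun i x => r i (x i)
  have hXm : ∀ i, Measurable (X i) := fun i => (hr i).comp (measurable_pi_apply i)
  have hX : ∀ i, MemLp (X i) 2 (pim μ) := fun i =>
    MemLp.of_bound (hXm i).aestronglyMeasurable l (by filter_upwards with x using hb i _)
  have hR : ∀ i, MemLp (r i) 2 μ := fun i =>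
    MemLp.of_bound (hr i).aestronglyMeasurable l (by filter_upwards with x using hb i _)
  have hS : MemLp (∑ i ∈ I, X i) 2 (pim μ) := memLp_finsetSum' _ fun i _ => hX i
  have e1 : ∫⁻ x, ‖∑ i ∈ I, (r i (x i) - ∫ w, r i w ∂μ)‖ₑ ^ 2 ∂(pim μ) = eVar[∑ i ∈ I, X i; pim μ] := by
    unfold evariance
    refine lintegral_congr fun x => ?_
    congr 2
    rw [Finset.sum_sub_distrib, Finset.sum_apply]
    congr 1
    simp only [Finset.sum_apply]
    rw [integral_finsetSum _ fun i _ => (hX i).integrable (by norm_num)]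
    exact Finset.sum_congr rfl fun i _ => (integral_eval i (hr i)).symm
  rw [e1, ← hS.ofReal_variance_eq, IndepFun.variance_sum (fun i _ => hX i)
    (fun i _ j _ hij => (indep (μ := μ) r hr).indepFun hij), ENNReal.ofReal_sum_of_nonneg (fun i _ => variance_nonneg _ _)]
  refine Finset.sum_le_sum fun i _ => ?_
  refine (ENNReal.ofReal_le_ofReal (variance_le_expectation_sq (hXm i).aestronglyMeasurable)).trans ?_
  have e2 : ∫ x, (X i ^ 2) x ∂(pim μ) = ∫ w, r i w ^ 2 ∂μ :=
    integral_eval (μ := μ) i (g := fun w => r i w ^ 2) ((hr i).pow_const 2)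
  rw [e2, ofReal_integral_eq_lintegral_ofReal (hR i).integrable_sq (by filter_upwards with x using sq_nonneg _)]
  refine lintegral_mono fun w => ?_
  rw [Real.enorm_eq_ofReal_abs, ← ENNReal.ofReal_pow (abs_nonneg _), sq_abs]

/-- components -/
noncomputable def fc (μ : Measure Ω) [IsProbabilityMeasure μ] (W : (ℕ → Ω) × ℝ → ℝ) (i : ℕ) (q : Ω × ℝ) : ℝ :=
  cav0 μ {i} (fun x => W (x, q.2)) (fun _ => q.1)

lemma fc_eq (W : (ℕ → Ω) × ℝ → ℝ) (i : ℕ) (x : ℕ → Ω) (s : ℝ) :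
    fc μ W i (x i, s) = cav0 μ {i} (fun x => W (x, s)) x := by
  rw [cav0_single]; rfl

lemma measurable_fc {W : (ℕ → Ω) × ℝ → ℝ} (hW : Measurable W) (i : ℕ) : Measurable (fc μ W i) := by
  have : Measurable (fun q : Ω × ℝ => ((fun _ => q.1 : ℕ → Ω), q.2)) := by fun_prop
  exact (measurable_Cav {i} hW).comp this

/-- good slices -/
def Good (μ : Measure Ω) [IsProbabilityMeasure μ] (W : (ℕ → Ω) × ℝ → ℝ) (s : ℝ) : Prop :=
  Integrable (fun x => W (x, s)) (pim μ) ∧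
  (∀ i, Integrable (fun ω => fc μ W i (ω, s)) μ ∧ ∫ ω, fc μ W i (ω, s) ∂μ = 0) ∧
  ∀ n, ∀ᵐ x ∂(pim μ), cav0 μ (Finset.range n) (fun x => W (x, s)) x = ∑ i ∈ Finset.range n, fc μ W i (x i, s)

lemma slice_add {u v : (ℕ → Ω) × ℝ → ℝ} (hu : MemV μ 1 u) (hv : MemV μ 2 v) (A : Finset ℕ) :
    ∀ᵐ z ∂(PP μ), Cav μ A (fun z => u z + v z) z = Cav μ A u z + Cav μ A v z := by
  refine ae_of_ae_ae (measurableSet_eq_fun (measurable_Cav A (hu.1.add hv.1)) ((measurable_Cav A hu.1).add (measurable_Cav A hv.1))) ?_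
  filter_upwards [slice_integrable le_rfl (by simp) hu.1 hu.2.1, slice_integrable (by norm_num) (by simp) hv.1 hv.2.1] with s hs1 hs2
  exact cav0_add A hs1 hs2

lemma sum_eq_W {u v : (ℕ → Ω) × ℝ → ℝ} (hu : MemV μ 1 u) (hv : MemV μ 2 v) (A : Finset ℕ) :
    ∀ᵐ z ∂(PP μ), Cav μ A (fun z => u z + v z) z = ∑ i ∈ A, Cav μ {i} (fun z => u z + v z) z := by
  filter_upwards [slice_add hu hv A, ae_all_iff.2 (fun i : ℕ => slice_add hu hv {i}),
    hu.sum_eq le_rfl (by simp) A, hv.sum_eq (by norm_num) (by simp) A] with z h1 h2 h3 h4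
  rw [h1, h3, h4, Finset.sum_congr rfl (fun i _ => h2 i), Finset.sum_add_distrib]

lemma good_ae {u v : (ℕ → Ω) × ℝ → ℝ} (hu : MemV μ 1 u) (hv : MemV μ 2 v) :
    ∀ᵐ s ∂(volume : Measure ℝ), Good μ (fun z => u z + v z) s := by
  have h0 := fun A => ae_ae_of_ae (sum_eq_W hu hv A)
  filter_upwards [slice_integrable le_rfl (by simp) hu.1 hu.2.1, slice_integrable (by norm_num) (by simp) hv.1 hv.2.1,
    ae_all_iff.2 (fun n => h0 (Finset.range n))] with s hs1 hs2 hs3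
  have hW : Integrable (fun x => u (x, s) + v (x, s)) (pim μ) := hs1.add hs2
  have hWm : Measurable (fun z => u z + v z) := hu.1.add hv.1
  refine ⟨hW, fun i => ?_, fun n => ?_⟩
  · have hm : Measurable (fun ω => fc μ (fun z => u z + v z) i (ω, s)) := (measurable_fc hWm i).comp measurable_prodMk_right
    have e : (fun x : ℕ → Ω => fc μ (fun z => u z + v z) i (x i, s)) = cav0 μ {i} (fun x => u (x, s) + v (x, s)) := by
      ext x; exact fc_eq _ i x s
    constructor
    · have h1 := integrable_cav0 {i} hW
      rw [← e] at h1
      exact ((mp_eval (μ := μ) i).integrable_comp hm.aestronglyMeasurable).1 h1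
    · rw [← integral_eval (μ := μ) i hm]
      change ∫ x, (fun x : ℕ → Ω => fc μ (fun z => u z + v z) i (x i, s)) x ∂(pim μ) = 0
      rw [e, integral_cav0 {i} hW]
      obtain ⟨x, hx⟩ := (hs3 0).exists
      have e0 : ∀ y : ℕ → Ω, (Finset.range 0).piecewise x y = y := fun y => by
        ext j; simp [Finset.piecewise]
      simp only [Cav, cav0, e0] at hx
      simpa using hx
  · filter_upwards [hs3 n] with x hx
    simp only [fc_eq]
    exact hx

lemma slice_B {l : ℝ} (hl : 0 < l) {W : (ℕ → Ω) × ℝ → ℝ} (hWm : Measurable W) {s : ℝ} (hg : Good μ W s)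
    (h : ∫⁻ x, ‖W (x, s)‖ₑ ∂(pim μ) ≤ ENNReal.ofReal (l / 4)) :
    ∑' i, ∫⁻ ω, ENNReal.ofReal (hub l (fc μ W i (ω, s))) ∂μ
      ≤ 8 * ∫⁻ x, ENNReal.ofReal (hub l (W (x, s))) ∂(pim μ) := by
  obtain ⟨hW, hf, hs⟩ := hg
  have hm : ∀ i, Measurable (fun ω => fc μ W i (ω, s)) := fun i => (measurable_fc hWm i).comp measurable_prodMk_right
  have h' : ∫ x, |W (x, s)| ∂(pim μ) ≤ l / 4 := by
    have := integral_norm_eq_lintegral_enorm hW.aestronglyMeasurable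
    simp only [Real.norm_eq_abs] at this
    rw [this]
    exact ENNReal.toReal_le_of_le_ofReal (by positivity) h
  have key : ∀ n, ∑ i ∈ Finset.range n, ∫ ω, hub l (fc μ W i (ω, s)) ∂μ ≤ 8 * ∫ x, hub l (W (x, s)) ∂(pim μ) := by
    intro n
    refine (core hl (fun i ω => fc μ W i (ω, s)) hm (fun i => (hf i).1) (fun i => (hf i).2) n ?_).trans ?_
    · intro k _
      refine le_trans (le_of_eq ?_) ((cav0_abs (Finset.range k) hW).trans h')
      refine integral_congr_ae ?_
      filter_upwards [hs k] with x hx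
      rw [hx]
    · refine mul_le_mul_of_nonneg_left ?_ (by norm_num)
      refine le_trans (le_of_eq ?_) (cav0_hub hl (Finset.range n) hW)
      refine integral_congr_ae ?_
      filter_upwards [hs n] with x hx
      rw [hx]
  rw [ENNReal.tsum_eq_iSup_nat]
  refine iSup_le fun n => ?_
  have e : ∀ i, ∫⁻ ω, ENNReal.ofReal (hub l (fc μ W i (ω, s))) ∂μ = ENNReal.ofReal (∫ ω, hub l (fc μ W i (ω, s)) ∂μ) :=
    fun i => (ofReal_integral_eq_lintegral_ofReal (integrable_hub hl (hf i).1)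
      (by filter_upwards with x using hub_nonneg hl _)).symm
  rw [Finset.sum_congr rfl (fun i _ => e i), ← ENNReal.ofReal_sum_of_nonneg
    (fun i _ => integral_nonneg fun x => hub_nonneg hl _), ← ofReal_integral_eq_lintegral_ofReal (integrable_hub hl hW)
      (by filter_upwards with x using hub_nonneg hl _)]
  refine (ENNReal.ofReal_le_ofReal (key n)).trans ?_
  rw [ENNReal.ofReal_mul (by norm_num)]; simp

lemma slice_A {l : ℝ} (hl : 0 < l) {W : (ℕ → Ω) × ℝ → ℝ} {s : ℝ} (hW : Integrable (fun x => W (x, s)) (pim μ))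
    (h : ENNReal.ofReal (l / 4) < ∫⁻ x, ‖W (x, s)‖ₑ ∂(pim μ)) :
    ∫⁻ x, ‖W (x, s)‖ₑ ∂(pim μ) ≤ ENNReal.ofReal (8 / l) * ∫⁻ x, ENNReal.ofReal (hub l (W (x, s))) ∂(pim μ) := by
  have e : ∫⁻ x, ‖W (x, s)‖ₑ ∂(pim μ) = ENNReal.ofReal (∫ x, |W (x, s)| ∂(pim μ)) :=
    (ofReal_integral_norm_eq_lintegral_enorm hW).symm
  rw [e] at h ⊢
  have h' : l / 4 < ∫ x, |W (x, s)| ∂(pim μ) := (ENNReal.ofReal_lt_ofReal_iff_of_nonneg (by positivity)).1 h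
  rw [← ofReal_integral_eq_lintegral_ofReal (integrable_hub hl hW)
      (by filter_upwards with x using hub_nonneg hl _), ← ENNReal.ofReal_mul (by positivity)]
  refine ENNReal.ofReal_le_ofReal ?_
  have h2 : ∫ x, (l / 4 * |W (x, s)| - l ^ 2 / 64) ∂(pim μ) ≤ ∫ x, hub l (W (x, s)) ∂(pim μ) :=
    integral_mono ((hW.abs.const_mul _).sub (integrable_const _)) (integrable_hub hl hW) fun x => hub_ge hl _
  rw [integral_sub (hW.abs.const_mul _) (integrable_const _), integral_const_mul] at h2
  simp only [integral_const, probReal_univ, one_smul] at h2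
  rw [div_mul_eq_mul_div, le_div_iff₀ hl]
  nlinarith

lemma J_bound {l : ℝ} (hl : 0 < l) {W F0 F1 : (ℕ → Ω) × ℝ → ℝ} (h1 : Measurable F1) (h0 : Measurable F0)
    (h : ∀ᵐ z ∂(PP μ), W z = F0 z + F1 z) :
    ∫⁻ z, ENNReal.ofReal (hub l (W z)) ∂(PP μ)
      ≤ ENNReal.ofReal (2 * l) * eLpNorm F0 1 (PP μ) + 2 * eLpNorm F1 2 (PP μ) ^ 2 := by
  have e2 : eLpNorm F1 2 (PP μ) ^ 2 = ∫⁻ z, ‖F1 z‖ₑ ^ 2 ∂(PP μ) := by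
    have := eLpNorm_nnreal_pow_eq_lintegral (f := F1) (μ := PP μ) (p := 2) (by norm_num)
    simpa using this
  rw [e2, eLpNorm_one_eq_lintegral_enorm, ← lintegral_const_mul _ (by fun_prop), ← lintegral_const_mul _ (by fun_prop),
    ← lintegral_add_left (by fun_prop)]
  refine lintegral_mono_ae ?_
  filter_upwards [h] with z hz
  rw [hz]
  refine (ENNReal.ofReal_le_ofReal (hub_add_le hl _ _)).trans ?_
  rw [ENNReal.ofReal_add (by positivity) (by positivity), ENNReal.ofReal_mul (by positivity), ENNReal.ofReal_mul (by positivity),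
    Real.enorm_eq_ofReal_abs, Real.enorm_eq_ofReal_abs, ← ENNReal.ofReal_pow (abs_nonneg _), sq_abs]
  simp

end Part4

section Part5

variable {μ : Measure Ω} [IsProbabilityMeasure μ]

lemma memV_of_tendsto {p : ℝ≥0∞} {w : (ℕ → Ω) × ℝ → ℝ} (hw : Measurable w)
    (g : ℕ → Ω × ℝ → ℝ) (gm : ∀ i, Measurable (g i))
    (g2 : ∀ i, ∀ᵐ s ∂(volume : Measure ℝ),
      Integrable (fun ω => g i (ω, s)) μ ∧ ∫ ω, g i (ω, s) ∂μ = 0)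
    (g3 : ∀ i, eLpNorm (fun z : (ℕ → Ω) × ℝ => g i (z.1 i, z.2)) p (PP μ) < ⊤)
    (h : Tendsto (fun n => eLpNorm (fun z => w z - ∑ i ∈ Finset.range n, g i (z.1 i, z.2)) p (PP μ))
      atTop (𝓝 0)) : MemV μ p w := by
  have hgm : ∀ i, Measurable (fun z : (ℕ → Ω) × ℝ => (g i) (z.1 i, z.2)) := fun i =>
    (gm i).comp (by fun_prop)
  have key : ∀ ε : ℝ, 0 < ε → ∃ n, eLpNorm (fun z => w z - ∑ i ∈ Finset.range n, g i (z.1 i, z.2)) p (PP μ)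
      ≤ ENNReal.ofReal ε := by
    intro ε hε
    have := (h.eventually (ge_mem_nhds (ENNReal.ofReal_pos.2 hε))).exists
    exact this
  refine ⟨hw, ?_, fun ε hε => ?_⟩
  · obtain ⟨n, hn⟩ := key 1 one_pos
    have m1 : MemLp (fun z => w z - ∑ i ∈ Finset.range n, g i (z.1 i, z.2)) p (PP μ) :=
      ⟨(hw.sub (Finset.measurable_sum _ fun i _ => hgm i)).aestronglyMeasurable,
        hn.trans_lt ENNReal.ofReal_lt_top⟩
    have m2 : MemLp (fun z : (ℕ → Ω) × ℝ => ∑ i ∈ Finset.range n, g i (z.1 i, z.2)) p (PP μ) :=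
      memLp_finsetSum _ fun i _ => ⟨(hgm i).aestronglyMeasurable, g3 i⟩
    have := (m1.add m2).2
    simpa [Pi.add_def] using this
  · obtain ⟨n, hn⟩ := key ε hε
    exact ⟨n, g, gm, g2, g3, hn⟩

lemma series_L1 {X : Type*} [MeasurableSpace X] {P : Measure X} (a : ℕ → X → ℝ) (ha : ∀ i, Measurable (a i))
    (h : ∑' i, eLpNorm (a i) 1 P ≠ ⊤) :
    ∃ G : X → ℝ, Measurable G ∧
      (∀ᵐ x ∂P, Tendsto (fun n => ∑ i ∈ Finset.range n, a i x) atTop (𝓝 (G x))) ∧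
      ∀ m, eLpNorm (fun x => G x - ∑ i ∈ Finset.range m, a i x) 1 P ≤ ∑' i, eLpNorm (a (i + m)) 1 P := by
  have hs : ∀ᵐ x ∂P, ∑' i, ‖a i x‖ₑ < ⊤ := by
    refine ae_lt_top (Measurable.tsum fun i => (ha i).enorm) ?_
    rw [lintegral_tsum fun i => (ha i).enorm.aemeasurable]
    simpa [eLpNorm_one_eq_lintegral_enorm] using h
  have hS : ∀ᵐ x ∂P, Summable (fun i => a i x) := by
    filter_upwards [hs] with x hx
    have : ∑' i, ‖a i x‖ₑ ≠ ⊤ := hx.ne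
    exact Summable.of_norm (by
      have := (ENNReal.tsum_coe_ne_top_iff_summable (f := fun i => ‖a i x‖₊)).1 this
      exact NNReal.summable_coe.2 this)
  obtain ⟨G, hG, hGt⟩ := measurable_limit_of_tendsto_metrizable_ae (μ := P) (L := atTop)
    (f := fun n x => ∑ i ∈ Finset.range n, a i x)
    (fun n => (Finset.measurable_sum _ fun i _ => ha i).aemeasurable)
    (by filter_upwards [hS] with x hx using ⟨_, hx.hasSum.tendsto_sum_nat⟩)
  refine ⟨G, hG, hGt, fun m => ?_⟩
  simp only [eLpNorm_one_eq_lintegral_enorm]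
  rw [← lintegral_tsum fun i => (ha _).enorm.aemeasurable]
  refine lintegral_mono_ae ?_
  filter_upwards [hS, hGt] with x hx hx2
  have hGx : G x = ∑' i, a i x := tendsto_nhds_unique hx2 hx.hasSum.tendsto_sum_nat
  have : G x - ∑ i ∈ Finset.range m, a i x = ∑' i, a (i + m) x := by
    rw [hGx, ← hx.sum_add_tsum_nat_add m]; ring
  rw [this]
  exact enorm_tsum_le_tsum_enorm

/-- large part of the components -/
noncomputable def tl (μ : Measure Ω) [IsProbabilityMeasure μ] (l : ℝ) (W : (ℕ → Ω) × ℝ → ℝ) (i : ℕ) (q : Ω × ℝ) : ℝ :=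
  if |fc μ W i q| ≤ l then 0 else fc μ W i q
/-- small part of the components -/
noncomputable def rl (μ : Measure Ω) [IsProbabilityMeasure μ] (l : ℝ) (W : (ℕ → Ω) × ℝ → ℝ) (i : ℕ) (q : Ω × ℝ) : ℝ :=
  if |fc μ W i q| ≤ l then fc μ W i q else 0
open Classical in
/-- indicator -/
noncomputable def ind (B : Set ℝ) (s : ℝ) : ℝ := if s ∈ B then 1 else 0
/-- centred large part -/
noncomputable def aa (μ : Measure Ω) [IsProbabilityMeasure μ] (l : ℝ) (W : (ℕ → Ω) × ℝ → ℝ) (B : Set ℝ) (i : ℕ) (q : Ω × ℝ) : ℝ :=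
  ind B q.2 * (tl μ l W i q - ∫ ω, tl μ l W i (ω, q.2) ∂μ)
/-- centred small part -/
noncomputable def bb (μ : Measure Ω) [IsProbabilityMeasure μ] (l : ℝ) (W : (ℕ → Ω) × ℝ → ℝ) (B : Set ℝ) (i : ℕ) (q : Ω × ℝ) : ℝ :=
  ind B q.2 * (rl μ l W i q - ∫ ω, rl μ l W i (ω, q.2) ∂μ)
/-- energy of a component -/
noncomputable def en (μ : Measure Ω) [IsProbabilityMeasure μ] (l : ℝ) (W : (ℕ → Ω) × ℝ → ℝ) (B : Set ℝ) (i : ℕ) : ℝ≥0∞ :=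
  ∫⁻ s in B, ∫⁻ ω, ENNReal.ofReal (hub l (fc μ W i (ω, s))) ∂μ

lemma measurable_ind {B : Set ℝ} (hB : MeasurableSet B) : Measurable (ind B) :=
  Measurable.ite hB measurable_const measurable_const

lemma measurable_tl {l : ℝ} {W : (ℕ → Ω) × ℝ → ℝ} (hW : Measurable W) (i : ℕ) : Measurable (tl μ l W i) := by
  have := measurable_fc (μ := μ) hW i
  exact Measurable.ite (measurableSet_le (by fun_prop) measurable_const) measurable_const this

lemma measurable_rl {l : ℝ} {W : (ℕ → Ω) × ℝ → ℝ} (hW : Measurable W) (i : ℕ) : Measurable (rl μ l W i) := by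
  have := measurable_fc (μ := μ) hW i
  exact Measurable.ite (measurableSet_le (by fun_prop) measurable_const) this measurable_const

lemma meas_int {f : Ω × ℝ → ℝ} (hf : Measurable f) : Measurable (fun s : ℝ => ∫ ω, f (ω, s) ∂μ) := by
  have : Measurable (fun q : ℝ × Ω => f (q.2, q.1)) := hf.comp (by fun_prop)
  exact this.stronglyMeasurable.integral_prod_right'.measurable

lemma measurable_aa {l : ℝ} {W : (ℕ → Ω) × ℝ → ℝ} (hW : Measurable W) {B : Set ℝ} (hB : MeasurableSet B) (i : ℕ) :
    Measurable (aa μ l W B i) :=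
  ((measurable_ind hB).comp measurable_snd).mul
    ((measurable_tl hW i).sub ((meas_int (measurable_tl hW i)).comp measurable_snd))

lemma measurable_bb {l : ℝ} {W : (ℕ → Ω) × ℝ → ℝ} (hW : Measurable W) {B : Set ℝ} (hB : MeasurableSet B) (i : ℕ) :
    Measurable (bb μ l W B i) :=
  ((measurable_ind hB).comp measurable_snd).mul
    ((measurable_rl hW i).sub ((meas_int (measurable_rl hW i)).comp measurable_snd))

lemma rl_bound {l : ℝ} (hl : 0 < l) (W : (ℕ → Ω) × ℝ → ℝ) (i : ℕ) (q : Ω × ℝ) : |rl μ l W i q| ≤ l := by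
  unfold rl; split_ifs with h
  · exact h
  · simpa using hl.le

lemma rl_int {l : ℝ} (hl : 0 < l) {W : (ℕ → Ω) × ℝ → ℝ} (hW : Measurable W) (i : ℕ) (s : ℝ) :
    Integrable (fun ω => rl μ l W i (ω, s)) μ :=
  Integrable.of_bound ((measurable_rl hW i).comp (by fun_prop)).aestronglyMeasurable l
    (by filter_upwards with x using rl_bound hl W i _)

lemma tl_add_rl (l : ℝ) (W : (ℕ → Ω) × ℝ → ℝ) (i : ℕ) (q : Ω × ℝ) : tl μ l W i q = fc μ W i q - rl μ l W i q := by
  unfold tl rl; split_ifs <;> simp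

lemma tl_int {l : ℝ} (hl : 0 < l) {W : (ℕ → Ω) × ℝ → ℝ} (hW : Measurable W) (i : ℕ) {s : ℝ} (hg : Good μ W s) :
    Integrable (fun ω => tl μ l W i (ω, s)) μ := by
  simp only [tl_add_rl]
  exact (hg.2.1 i).1.sub (rl_int hl hW i s)

lemma aa_add_bb {l : ℝ} (hl : 0 < l) {W : (ℕ → Ω) × ℝ → ℝ} (hW : Measurable W) (B : Set ℝ) (i : ℕ) {s : ℝ} (hg : Good μ W s) (ω : Ω) :
    aa μ l W B i (ω, s) + bb μ l W B i (ω, s) = ind B s * fc μ W i (ω, s) := by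
  have : ∫ ω, tl μ l W i (ω, s) ∂μ = - ∫ ω, rl μ l W i (ω, s) ∂μ := by
    simp only [tl_add_rl]
    rw [integral_sub (hg.2.1 i).1 (rl_int hl hW i s), (hg.2.1 i).2, zero_sub]
  simp only [aa, bb, this]
  rw [tl_add_rl]; ring

lemma aa_mean {l : ℝ} (hl : 0 < l) {W : (ℕ → Ω) × ℝ → ℝ} (hW : Measurable W) (B : Set ℝ) (i : ℕ) {s : ℝ} (hg : Good μ W s) :
    Integrable (fun ω => aa μ l W B i (ω, s)) μ ∧ ∫ ω, aa μ l W B i (ω, s) ∂μ = 0 := by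
  have h := tl_int hl hW i hg
  constructor
  · simp only [aa]
    exact Integrable.const_mul (f := fun ω => tl μ l W i (ω, s) - ∫ ω, tl μ l W i (ω, s) ∂μ) (h.sub (integrable_const _)) _
  · simp only [aa]
    rw [integral_const_mul, integral_sub h (integrable_const _)]; simp

lemma bb_mean {l : ℝ} (hl : 0 < l) {W : (ℕ → Ω) × ℝ → ℝ} (hW : Measurable W) (B : Set ℝ) (i : ℕ) (s : ℝ) :
    Integrable (fun ω => bb μ l W B i (ω, s)) μ ∧ ∫ ω, bb μ l W B i (ω, s) ∂μ = 0 := by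
  have h := rl_int (μ := μ) hl hW i s
  constructor
  · simp only [bb]
    exact Integrable.const_mul (f := fun ω => rl μ l W i (ω, s) - ∫ ω, rl μ l W i (ω, s) ∂μ) (h.sub (integrable_const _)) _
  · simp only [bb]
    rw [integral_const_mul, integral_sub h (integrable_const _)]; simp

lemma tl_le {l : ℝ} (hl : 0 < l) (W : (ℕ → Ω) × ℝ → ℝ) (i : ℕ) (q : Ω × ℝ) :
    ‖tl μ l W i q‖ₑ ≤ ENNReal.ofReal (1 / l) * ENNReal.ofReal (hub l (fc μ W i q)) := by
  rw [← ENNReal.ofReal_mul (by positivity), Real.enorm_eq_ofReal_abs]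
  apply ENNReal.ofReal_le_ofReal
  unfold tl; split_ifs with h
  · have := hub_nonneg hl (fc μ W i q); simp; positivity
  · have := hub_ge_of_lt hl (not_le.1 h)
    rw [one_div, le_inv_mul_iff₀ hl]; exact this

lemma rl_le {l : ℝ} (hl : 0 < l) (W : (ℕ → Ω) × ℝ → ℝ) (i : ℕ) (q : Ω × ℝ) :
    ‖rl μ l W i q‖ₑ ^ 2 ≤ ENNReal.ofReal (hub l (fc μ W i q)) := by
  rw [Real.enorm_eq_ofReal_abs, ← ENNReal.ofReal_pow (abs_nonneg _), sq_abs]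
  apply ENNReal.ofReal_le_ofReal
  unfold rl; split_ifs with h
  · rw [hub_eq_of_le h]
  · simpa using hub_nonneg hl (fc μ W i q)

lemma en_sum {l : ℝ} (hl : 0 < l) {W : (ℕ → Ω) × ℝ → ℝ} (hW : Measurable W) {B : Set ℝ} (hB : MeasurableSet B)
    (hBs : ∀ s ∈ B, ∫⁻ x, ‖W (x, s)‖ₑ ∂(pim μ) ≤ ENNReal.ofReal (l / 4))
    (hg : ∀ᵐ s ∂(volume : Measure ℝ), Good μ W s) :
    ∑' i, en μ l W B i ≤ 8 * ∫⁻ z, ENNReal.ofReal (hub l (W z)) ∂(PP μ) := by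
  unfold en
  have hm : ∀ i, Measurable (fun s : ℝ => ∫⁻ ω, ENNReal.ofReal (hub l (fc μ W i (ω, s))) ∂μ) := fun i =>
    Measurable.lintegral_prod_left' (f := fun q => ENNReal.ofReal (hub l (fc μ W i q)))
      ((measurable_hub l).comp (measurable_fc hW i)).ennreal_ofReal
  rw [← lintegral_tsum fun i => (hm i).aemeasurable,
    lintegral_prod_symm (fun z => ENNReal.ofReal (hub l (W z))) ((measurable_hub l).comp hW).ennreal_ofReal.aemeasurable]
  rw [← lintegral_const_mul' _ _ (by simp)]
  refine le_trans (lintegral_mono_ae (g := fun s => 8 * ∫⁻ x, ENNReal.ofReal (hub l (W (x, s))) ∂(pim μ)) ?_) (setLIntegral_le_lintegral B _)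
  filter_upwards [ae_restrict_of_ae hg, ae_restrict_mem hB] with s h1 h2
  exact slice_B hl hW h1 (hBs s h2)

lemma ind_lint {B : Set ℝ} (hB : MeasurableSet B) (f : ℝ → ℝ≥0∞) :
    ∫⁻ s, ‖ind B s‖ₑ * f s = ∫⁻ s in B, f s := by
  rw [← lintegral_indicator hB]
  congr 1; ext s
  by_cases h : s ∈ B <;> simp [ind, h]

lemma aa_norm {l : ℝ} (hl : 0 < l) {W : (ℕ → Ω) × ℝ → ℝ} (hW : Measurable W) {B : Set ℝ} (hB : MeasurableSet B) (i : ℕ) :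
    eLpNorm (fun z : (ℕ → Ω) × ℝ => aa μ l W B i (z.1 i, z.2)) 1 (PP μ) ≤ ENNReal.ofReal (2 / l) * en μ l W B i := by
  have hm : Measurable (fun z : (ℕ → Ω) × ℝ => aa μ l W B i (z.1 i, z.2)) :=
    (measurable_aa hW hB i).comp (by fun_prop)
  have htm := measurable_tl (μ := μ) (l := l) hW i
  rw [eLpNorm_PP le_rfl (by simp) hm]
  simp only [ENNReal.toReal_one, ENNReal.rpow_one, div_one]
  unfold en
  rw [← lintegral_const_mul' _ _ (by simp), ← ind_lint hB]
  refine lintegral_mono fun s => ?_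
  simp only [aa, enorm_mul]
  rw [lintegral_const_mul' _ _ (by simp)]
  gcongr
  have htm' : Measurable (fun ω => tl μ l W i (ω, s)) := htm.comp (by fun_prop)
  set c := ∫ ω, tl μ l W i (ω, s) ∂μ
  have e := (mp_eval (μ := μ) i).lintegral_comp (f := fun ω => ‖tl μ l W i (ω, s) - c‖ₑ) (by fun_prop)
  rw [e]
  calc ∫⁻ ω, ‖tl μ l W i (ω, s) - c‖ₑ ∂μ ≤ ∫⁻ ω, (‖tl μ l W i (ω, s)‖ₑ + ‖c‖ₑ) ∂μ :=
        lintegral_mono fun ω => enorm_sub_le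
    _ = ∫⁻ ω, ‖tl μ l W i (ω, s)‖ₑ ∂μ + ‖c‖ₑ := by
        rw [lintegral_add_left (by fun_prop)]; simp
    _ ≤ ∫⁻ ω, ‖tl μ l W i (ω, s)‖ₑ ∂μ + ∫⁻ ω, ‖tl μ l W i (ω, s)‖ₑ ∂μ := by
        gcongr; exact enorm_integral_le_lintegral_enorm _
    _ = 2 * ∫⁻ ω, ‖tl μ l W i (ω, s)‖ₑ ∂μ := by ring
    _ ≤ 2 * ∫⁻ ω, ENNReal.ofReal (1 / l) * ENNReal.ofReal (hub l (fc μ W i (ω, s))) ∂μ := by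
        gcongr; exact tl_le hl W i _
    _ = _ := by
        rw [lintegral_const_mul' _ _ (by simp), ← mul_assoc]
        congr 1
        rw [show (2 : ℝ≥0∞) = ENNReal.ofReal 2 by simp, ← ENNReal.ofReal_mul (by norm_num)]
        congr 1; ring

lemma bb_norm {l : ℝ} (hl : 0 < l) {W : (ℕ → Ω) × ℝ → ℝ} (hW : Measurable W) {B : Set ℝ} (hB : MeasurableSet B) (I : Finset ℕ) :
    eLpNorm (fun z : (ℕ → Ω) × ℝ => ∑ i ∈ I, bb μ l W B i (z.1 i, z.2)) 2 (PP μ) ≤ (∑ i ∈ I, en μ l W B i) ^ ((1:ℝ)/2) := by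
  have hm : Measurable (fun z : (ℕ → Ω) × ℝ => ∑ i ∈ I, bb μ l W B i (z.1 i, z.2)) :=
    Finset.measurable_sum _ fun i _ => (measurable_bb hW hB i).comp (by fun_prop)
  rw [eLpNorm_PP (by norm_num) (by simp) hm]
  simp only [ENNReal.toReal_ofNat, ENNReal.rpow_ofNat]
  gcongr
  unfold en
  have hmm : ∀ i, Measurable (fun s : ℝ => ∫⁻ ω, ENNReal.ofReal (hub l (fc μ W i (ω, s))) ∂μ) := fun i =>
    Measurable.lintegral_prod_left' (f := fun q => ENNReal.ofReal (hub l (fc μ W i q)))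
      ((measurable_hub l).comp (measurable_fc hW i)).ennreal_ofReal
  rw [← lintegral_finsetSum _ fun i _ => hmm i, ← ind_lint hB]
  refine lintegral_mono fun s => ?_
  simp only [bb]
  by_cases hs : s ∈ B
  · simp only [ind, hs, if_true, one_mul, enorm_one]
    refine (ortho (l := l) (fun i ω => rl μ l W i (ω, s)) (fun i => (measurable_rl hW i).comp (by fun_prop))
      (fun i w => rl_bound hl W i _) I).trans ?_
    gcongr with i hi ω
    exact rl_le hl W i _
  · simp [ind, hs]

end Part5

section Part6

variable {μ : Measure Ω} [IsProbabilityMeasure μ]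

lemma subseq {u v : (ℕ → Ω) × ℝ → ℝ} (hu : MemV μ 1 u) (hv : MemV μ 2 v) :
    ∃ ns : ℕ → ℕ, Tendsto ns atTop atTop ∧ ∀ᵐ z ∂(PP μ),
      Tendsto (fun k => Cav μ (Finset.range (ns k)) (fun z => u z + v z) z) atTop (𝓝 (u z + v z)) := by
  have m : ∀ {p : ℝ≥0∞} {w}, MemV μ p w → ∀ n, AEStronglyMeasurable (Cav μ (Finset.range n) w) (PP μ) :=
    fun h n => (measurable_Cav _ h.1).aestronglyMeasurable
  have t1 : TendstoInMeasure (PP μ) (fun n => Cav μ (Finset.range n) u) atTop u :=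
    tendstoInMeasure_of_tendsto_eLpNorm (p := 1) (by simp) (m hu) hu.1.aestronglyMeasurable
      (hu.tendsto le_rfl (by simp))
  have t2 : TendstoInMeasure (PP μ) (fun n => Cav μ (Finset.range n) v) atTop v :=
    tendstoInMeasure_of_tendsto_eLpNorm (p := 2) (by simp) (m hv) hv.1.aestronglyMeasurable
      (hv.tendsto (by norm_num) (by simp))
  obtain ⟨n1, hn1, h1⟩ := t1.exists_seq_tendsto_ae
  have t3 : TendstoInMeasure (PP μ) (fun k => Cav μ (Finset.range (n1 k)) v) atTop v :=
    fun ε hε => (t2 ε hε).comp hn1.tendsto_atTop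
  obtain ⟨n2, hn2, h2⟩ := t3.exists_seq_tendsto_ae
  refine ⟨fun k => n1 (n2 k), hn1.tendsto_atTop.comp hn2.tendsto_atTop, ?_⟩
  filter_upwards [h1, h2, ae_all_iff.2 fun n => slice_add hu hv (Finset.range n)] with z a1 a2 a3
  simp only [a3]
  exact (a1.comp hn2.tendsto_atTop).add a2

lemma indA_bound {A : Set ℝ} (hA : MeasurableSet A) {f g : (ℕ → Ω) × ℝ → ℝ} (hf : Measurable f) (hg : Measurable g) :
    eLpNorm (fun z => ind A z.2 * (f z + g z)) 1 (PP μ)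
      ≤ eLpNorm f 1 (PP μ) + volume A ^ ((1:ℝ)/2) * eLpNorm g 2 (PP μ) := by
  have hi : Measurable (fun z : (ℕ → Ω) × ℝ => ind A z.2) := (measurable_ind hA).comp measurable_snd
  have e : eLpNorm (fun z : (ℕ → Ω) × ℝ => ind A z.2) 2 (PP μ) = volume A ^ ((1:ℝ)/2) := by
    rw [eLpNorm_PP (by norm_num) (by simp) hi]
    simp only [ENNReal.toReal_ofNat, ENNReal.rpow_ofNat, lintegral_const, measure_univ, mul_one]
    congr 1
    have := ind_lint hA (fun s => ‖ind A s‖ₑ)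
    simp only [← pow_two] at this
    rw [this]
    rw [setLIntegral_congr_fun (g := fun _ => 1) hA (fun s hs => by simp [ind, hs])]
    simp
  have h2 := eLpNorm_smul_le_mul_eLpNorm (p := 2) (q := 2) (r := 1) (μ := PP μ)
    hg.aestronglyMeasurable hi.aestronglyMeasurable
  rw [e] at h2
  have h3 : eLpNorm (fun z => ind A z.2 * f z) 1 (PP μ) ≤ eLpNorm f 1 (PP μ) := by
    refine eLpNorm_mono fun z => ?_
    by_cases h : z.2 ∈ A <;> simp [ind, h]
  have h4 : (fun z : (ℕ → Ω) × ℝ => ind A z.2 * (f z + g z)) = (fun z : (ℕ → Ω) × ℝ => ind A z.2 * f z) + (fun z : (ℕ → Ω) × ℝ => ind A z.2) • g := by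
    ext z; simp [mul_add]
  rw [h4]
  exact (eLpNorm_add_le (hi.mul hf).aestronglyMeasurable (hi.smul hg).aestronglyMeasurable le_rfl).trans
    (add_le_add h3 h2)

lemma construct {u v : (ℕ → Ω) × ℝ → ℝ} (hu : MemV μ 1 u) (hv : MemV μ 2 v) {l : ℝ} (hl : 0 < l)
    {J : ℝ≥0∞} (hJ : J = ∫⁻ z, ENNReal.ofReal (hub l (u z + v z)) ∂(PP μ)) (hJt : J ≠ ⊤) :
    ∃ G0 G1 : (ℕ → Ω) × ℝ → ℝ, MemV μ 1 G0 ∧ MemV μ 2 G1 ∧ (∀ z, u z + v z = G0 z + G1 z) ∧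
      eLpNorm G0 1 (PP μ) ≤ ENNReal.ofReal (24 / l) * J ∧
      eLpNorm G1 2 (PP μ) ≤ (8 * J) ^ ((1:ℝ)/2) := by
  set W : (ℕ → Ω) × ℝ → ℝ := fun z => u z + v z with hWdef
  have hW : Measurable W := hu.1.add hv.1
  have hWf : Measurable (fun s : ℝ => ∫⁻ x, ‖W (x, s)‖ₑ ∂(pim μ)) :=
    Measurable.lintegral_prod_left' (f := fun q => ‖W q‖ₑ) hW.enorm
  have hg : ∀ᵐ s ∂(volume : Measure ℝ), Good μ W s := good_ae hu hv
  have hgz : ∀ᵐ z ∂(PP μ), Good μ W z.2 := Measure.quasiMeasurePreserving_snd.ae hg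
  set A : Set ℝ := {s | ENNReal.ofReal (l / 4) < ∫⁻ x, ‖W (x, s)‖ₑ ∂(pim μ)} with hA
  have hAm : MeasurableSet A := measurableSet_lt measurable_const hWf
  set B : Set ℝ := Aᶜ with hB
  have hBm : MeasurableSet B := hAm.compl
  have hBs : ∀ s ∈ B, ∫⁻ x, ‖W (x, s)‖ₑ ∂(pim μ) ≤ ENNReal.ofReal (l / 4) := fun s hs => not_lt.1 hs
  have hAB : ∀ s, ind A s + ind B s = 1 := fun s => by by_cases h : s ∈ A <;> simp [ind, hB, h]
  have hindA : Measurable (fun z : (ℕ → Ω) × ℝ => ind A z.2) := (measurable_ind hAm).comp measurable_snd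
  have hindB : Measurable (fun z : (ℕ → Ω) × ℝ => ind B z.2) := (measurable_ind hBm).comp measurable_snd
  have hE : ∑' i, en μ l W B i ≤ 8 * J := by rw [hJ]; exact en_sum hl hW hBm hBs hg
  have hEt : ∑' i, en μ l W B i ≠ ⊤ := ne_top_of_le_ne_top (ENNReal.mul_ne_top (by simp) hJt) hE
  -- the set A
  have hAW : ∫⁻ s in A, ∫⁻ x, ‖W (x, s)‖ₑ ∂(pim μ) ≤ ENNReal.ofReal (8 / l) * J := by
    rw [hJ, lintegral_prod_symm (fun z => ENNReal.ofReal (hub l (u z + v z)))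
      ((measurable_hub l).comp hW).ennreal_ofReal.aemeasurable, ← lintegral_const_mul' _ _ (by simp)]
    refine le_trans (lintegral_mono_ae (g := fun s => ENNReal.ofReal (8 / l) * ∫⁻ x, ENNReal.ofReal (hub l (W (x, s))) ∂(pim μ)) ?_)
      (setLIntegral_le_lintegral A _)
    filter_upwards [ae_restrict_of_ae hg, ae_restrict_mem hAm] with s h1 h2
    exact slice_A hl h1.1 h2
  have hAWt : ∫⁻ s in A, ∫⁻ x, ‖W (x, s)‖ₑ ∂(pim μ) ≠ ⊤ :=
    ne_top_of_le_ne_top (ENNReal.mul_ne_top (by simp) hJt) hAW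
  have hvA : volume A ≠ ⊤ := by
    intro h
    apply hAWt
    rw [eq_top_iff]
    calc ⊤ = ENNReal.ofReal (l / 4) * volume A := by
          rw [h, ENNReal.mul_top]; simpa using hl
      _ = ∫⁻ s in A, ENNReal.ofReal (l / 4) := by simp
      _ ≤ _ := setLIntegral_mono hWf fun s hs => le_of_lt hs
  have hc : volume A ^ ((1:ℝ)/2) ≠ ⊤ := ENNReal.rpow_ne_top_of_nonneg (by norm_num) hvA
  have hAn : eLpNorm (fun z => ind A z.2 * W z) 1 (PP μ) ≤ ENNReal.ofReal (8 / l) * J := by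
    rw [eLpNorm_PP (w := fun z => ind A z.2 * W z) le_rfl (by simp) (hindA.mul hW)]
    simp only [ENNReal.toReal_one, ENNReal.rpow_one, div_one, enorm_mul]
    refine le_trans (le_of_eq ?_) hAW
    rw [← ind_lint hAm]
    congr 1; ext s
    rw [lintegral_const_mul' _ _ (by simp)]
  -- the series
  have haam : ∀ i, Measurable (fun z : (ℕ → Ω) × ℝ => aa μ l W B i (z.1 i, z.2)) := fun i =>
    (measurable_aa hW hBm i).comp (by fun_prop)
  have hbbm : ∀ i, Measurable (fun z : (ℕ → Ω) × ℝ => bb μ l W B i (z.1 i, z.2)) := fun i =>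
    (measurable_bb hW hBm i).comp (by fun_prop)
  have hfcm : ∀ i, Measurable (fun z : (ℕ → Ω) × ℝ => fc μ W i (z.1 i, z.2)) := fun i =>
    (measurable_fc hW i).comp (by fun_prop)
  have haas : ∑' i, eLpNorm (fun z : (ℕ → Ω) × ℝ => aa μ l W B i (z.1 i, z.2)) 1 (PP μ)
      ≤ ENNReal.ofReal (16 / l) * J := by
    calc _ ≤ ∑' i, ENNReal.ofReal (2 / l) * en μ l W B i := ENNReal.tsum_le_tsum fun i => aa_norm hl hW hBm i
      _ = ENNReal.ofReal (2 / l) * ∑' i, en μ l W B i := ENNReal.tsum_mul_left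
      _ ≤ ENNReal.ofReal (2 / l) * (8 * J) := by gcongr
      _ = _ := by
        rw [← mul_assoc]; congr 1
        rw [show (8 : ℝ≥0∞) = ENNReal.ofReal 8 by simp, ← ENNReal.ofReal_mul (by positivity)]
        congr 1; ring
  have haat : ∑' i, eLpNorm (fun z : (ℕ → Ω) × ℝ => aa μ l W B i (z.1 i, z.2)) 1 (PP μ) ≠ ⊤ :=
    ne_top_of_le_ne_top (ENNReal.mul_ne_top (by simp) hJt) haas
  obtain ⟨G, hGm, hGt, hGn⟩ := series_L1 (P := PP μ) (fun i z => aa μ l W B i (z.1 i, z.2)) haam haat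
  have hfcC : ∀ i z, fc μ W i (z.1 i, z.2) = Cav μ {i} W z := fun i z => fc_eq W i z.1 z.2
  have hsum : ∀ᵐ z ∂(PP μ), ∀ n, Cav μ (Finset.range n) W z = ∑ i ∈ Finset.range n, fc μ W i (z.1 i, z.2) := by
    rw [ae_all_iff]; intro n
    filter_upwards [sum_eq_W hu hv (Finset.range n)] with z hz
    simp only [hfcC]; exact hz
  have hbsum : ∀ᵐ z ∂(PP μ), ∀ n, ∑ i ∈ Finset.range n, bb μ l W B i (z.1 i, z.2)
      = ind B z.2 * Cav μ (Finset.range n) W z - ∑ i ∈ Finset.range n, aa μ l W B i (z.1 i, z.2) := by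
    filter_upwards [hgz, hsum] with z h1 h2 n
    rw [h2, Finset.mul_sum, eq_sub_iff_add_eq', ← Finset.sum_add_distrib]
    exact Finset.sum_congr rfl fun i _ => aa_add_bb hl hW B i h1 _
  obtain ⟨ns, hns, hnsW⟩ := subseq hu hv
  have hDt : ∀ᵐ z ∂(PP μ), Tendsto (fun k => ∑ i ∈ Finset.range (ns k), bb μ l W B i (z.1 i, z.2)) atTop
      (𝓝 (ind B z.2 * W z - G z)) := by
    filter_upwards [hbsum, hnsW, hGt] with z h1 h2 h3
    simp only [h1]
    exact (h2.const_mul _).sub (h3.comp hns)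
  have hG1m : Measurable (fun z => ind B z.2 * W z - G z) := (hindB.mul hW).sub hGm
  have hG1n : ∀ m, eLpNorm (fun z => (ind B z.2 * W z - G z) - ∑ i ∈ Finset.range m, bb μ l W B i (z.1 i, z.2)) 2 (PP μ)
      ≤ (∑' i, en μ l W B (i + m)) ^ ((1:ℝ)/2) := by
    intro m
    refine Lp.eLpNorm_le_of_ae_tendsto (u := atTop) (f := fun k z => ∑ i ∈ Finset.range (ns k), bb μ l W B i (z.1 i, z.2)
      - ∑ i ∈ Finset.range m, bb μ l W B i (z.1 i, z.2)) ?_ ?_ ?_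
    · filter_upwards [hns.eventually_ge_atTop m] with k hk
      have : (fun z : (ℕ → Ω) × ℝ => ∑ i ∈ Finset.range (ns k), bb μ l W B i (z.1 i, z.2)
        - ∑ i ∈ Finset.range m, bb μ l W B i (z.1 i, z.2)) = fun z => ∑ i ∈ Finset.Ico m (ns k), bb μ l W B i (z.1 i, z.2) := by
        ext z; rw [Finset.sum_Ico_eq_sub _ hk]
      rw [this]
      refine (bb_norm hl hW hBm _).trans ?_
      gcongr
      rw [Finset.sum_Ico_eq_sum_range]
      simp only [add_comm m]
      exact ENNReal.sum_le_tsum _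
    · intro k
      exact ((Finset.measurable_sum _ fun i _ => hbbm i).sub (Finset.measurable_sum _ fun i _ => hbbm i)).aestronglyMeasurable
    · filter_upwards [hDt] with z hz
      exact hz.sub_const _
  refine ⟨fun z => ind A z.2 * W z + G z, fun z => ind B z.2 * W z - G z, ?_, ?_, ?_, ?_, ?_⟩
  · refine memV_of_tendsto ((hindA.mul hW).add hGm) (fun i q => ind A q.2 * fc μ W i q + aa μ l W B i q)
      (fun i => (((measurable_ind hAm).comp measurable_snd).mul (measurable_fc hW i)).add (measurable_aa hW hBm i))
      ?_ ?_ ?_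
    · intro i
      filter_upwards [hg] with s hs
      have h1 := aa_mean hl hW B i hs
      have h2 := hs.2.1 i
      refine ⟨(h2.1.const_mul _).add h1.1, ?_⟩
      rw [integral_add (h2.1.const_mul _) h1.1, integral_const_mul, h2.2, h1.2]; simp
    · intro i
      refine (eLpNorm_add_le (f := fun z : (ℕ → Ω) × ℝ => ind A z.2 * fc μ W i (z.1 i, z.2)) (g := fun z => aa μ l W B i (z.1 i, z.2))
        (hindA.mul (hfcm i)).aestronglyMeasurable (haam i).aestronglyMeasurable le_rfl).trans_lt ?_
      refine ENNReal.add_lt_top.2 ⟨?_, (ENNReal.ne_top_of_tsum_ne_top haat i).lt_top⟩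
      have : (fun z : (ℕ → Ω) × ℝ => ind A z.2 * fc μ W i (z.1 i, z.2)) =ᵐ[PP μ]
          fun z => ind A z.2 * (Cav μ {i} u z + Cav μ {i} v z) := by
        filter_upwards [slice_add hu hv {i}] with z hz
        rw [hfcC, ← hz]
      rw [eLpNorm_congr_ae this]
      refine (indA_bound hAm (measurable_Cav _ hu.1) (measurable_Cav _ hv.1)).trans_lt ?_
      refine ENNReal.add_lt_top.2 ⟨(Cav_norm le_rfl (by simp) _ hu.1).trans_lt hu.2.1, ENNReal.mul_lt_top hc.lt_top ?_⟩
      exact (Cav_norm (by norm_num) (by simp) _ hv.1).trans_lt hv.2.1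
    · have b : ∀ n, eLpNorm (fun z => ind A z.2 * W z + G z - ∑ i ∈ Finset.range n, (ind A z.2 * fc μ W i (z.1 i, z.2) + aa μ l W B i (z.1 i, z.2))) 1 (PP μ)
          ≤ (eLpNorm (fun z => Cav μ (Finset.range n) u z - u z) 1 (PP μ)
            + volume A ^ ((1:ℝ)/2) * eLpNorm (fun z => Cav μ (Finset.range n) v z - v z) 2 (PP μ))
            + ∑' i, eLpNorm (fun z : (ℕ → Ω) × ℝ => aa μ l W B (i + n) (z.1 (i + n), z.2)) 1 (PP μ) := by
        intro n
        have mu := (measurable_Cav (μ := μ) (Finset.range n) hu.1).sub hu.1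
        have mv := (measurable_Cav (μ := μ) (Finset.range n) hv.1).sub hv.1
        have e : (fun z => ind A z.2 * W z + G z - ∑ i ∈ Finset.range n, (ind A z.2 * fc μ W i (z.1 i, z.2) + aa μ l W B i (z.1 i, z.2)))
            =ᵐ[PP μ] (fun z => G z - ∑ i ∈ Finset.range n, aa μ l W B i (z.1 i, z.2))
              - fun z => ind A z.2 * ((Cav μ (Finset.range n) u z - u z) + (Cav μ (Finset.range n) v z - v z)) := by
          filter_upwards [hsum, slice_add hu hv (Finset.range n)] with z h1 h2
          have h1 := h1 n
          rw [h2] at h1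
          simp only [Finset.sum_add_distrib, ← Finset.mul_sum, ← h1, Pi.sub_apply]
          have hWz : W z = u z + v z := rfl
          rw [hWz]
          ring
        rw [eLpNorm_congr_ae e]
        refine (eLpNorm_sub_le (hGm.sub (Finset.measurable_sum _ fun i _ => haam i)).aestronglyMeasurable
          (hindA.mul (mu.add mv)).aestronglyMeasurable le_rfl).trans ?_
        rw [add_comm]
        exact add_le_add (indA_bound hAm mu mv) (hGn n)
      refine tendsto_of_tendsto_of_tendsto_of_le_of_le tendsto_const_nhds ?_ (fun _ => zero_le) b
      have t1 := hu.tendsto le_rfl (by simp)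
      have t2 := ENNReal.Tendsto.const_mul (hv.tendsto (by norm_num) (by simp)) (Or.inr hc)
      have t3 := ENNReal.tendsto_sum_nat_add (fun i => eLpNorm (fun z : (ℕ → Ω) × ℝ => aa μ l W B i (z.1 i, z.2)) 1 (PP μ)) haat
      simpa using (t1.add t2).add t3
  · refine memV_of_tendsto hG1m (fun i => bb μ l W B i) (fun i => measurable_bb hW hBm i)
      (fun i => ae_of_all _ fun s => bb_mean hl hW B i s) ?_ ?_
    · intro i
      have := bb_norm (μ := μ) hl hW hBm {i}
      simp only [Finset.sum_singleton] at this
      exact this.trans_lt (ENNReal.rpow_lt_top_of_nonneg (by norm_num) (ENNReal.ne_top_of_tsum_ne_top hEt i))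
    · refine tendsto_of_tendsto_of_tendsto_of_le_of_le tendsto_const_nhds ?_ (fun _ => zero_le) hG1n
      have t3 := (ENNReal.tendsto_sum_nat_add (fun i => en μ l W B i) hEt).ennrpow_const ((1:ℝ)/2)
      simpa using t3
  · intro z
    have := hAB z.2
    calc u z + v z = (ind A z.2 + ind B z.2) * W z := by rw [this, one_mul]
      _ = _ := by ring
  · have h0 := hGn 0
    simp only [Finset.range_zero, Finset.sum_empty, sub_zero, add_zero] at h0
    calc _ ≤ _ := eLpNorm_add_le (hindA.mul hW).aestronglyMeasurable hGm.aestronglyMeasurable le_rfl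
      _ ≤ ENNReal.ofReal (8 / l) * J + ENNReal.ofReal (16 / l) * J := add_le_add hAn (h0.trans haas)
      _ = _ := by
        rw [← add_mul, ← ENNReal.ofReal_add (by positivity) (by positivity)]
        congr 2; ring
  · have h0 := hG1n 0
    simp only [Finset.range_zero, Finset.sum_empty, sub_zero, add_zero] at h0
    refine h0.trans ?_
    gcongr

end Part6

section Part7

variable {μ : Measure Ω} [IsProbabilityMeasure μ]

lemma memV_zero (p : ℝ≥0∞) : MemV μ p (fun _ => 0) :=
  ⟨measurable_const, by simp, fun ε hε => ⟨0, fun _ _ => 0, fun _ => measurable_const,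
    fun _ => ae_of_all _ fun _ => by simp, fun _ => by simp, by simp⟩⟩

lemma main_PP {u v : (ℕ → Ω) × ℝ → ℝ} (hu : MemV μ 1 u) (hv : MemV μ 2 v) {t : ℝ} (ht : 0 < t)
    {F0 F1 : (ℕ → Ω) × ℝ → ℝ} (h0 : Measurable F0) (h1 : Measurable F1)
    (f0 : eLpNorm F0 1 (PP μ) < ⊤) (f1 : eLpNorm F1 2 (PP μ) < ⊤)
    (h : ∀ᵐ z ∂(PP μ), u z + v z = F0 z + F1 z) :
    ∃ G0 G1 : (ℕ → Ω) × ℝ → ℝ, MemV μ 1 G0 ∧ MemV μ 2 G1 ∧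
      (∀ᵐ z ∂(PP μ), u z + v z = G0 z + G1 z) ∧
      eLpNorm G0 1 (PP μ) + ENNReal.ofReal t * eLpNorm G1 2 (PP μ)
        ≤ ENNReal.ofReal 102 * (eLpNorm F0 1 (PP μ) + ENNReal.ofReal t * eLpNorm F1 2 (PP μ)) := by
  obtain ⟨a, ha, hae⟩ : ∃ a : ℝ, 0 ≤ a ∧ eLpNorm F0 1 (PP μ) = ENNReal.ofReal a :=
    ⟨_, ENNReal.toReal_nonneg, (ENNReal.ofReal_toReal f0.ne).symm⟩
  obtain ⟨b, hb, hbe⟩ : ∃ b : ℝ, 0 ≤ b ∧ eLpNorm F1 2 (PP μ) = ENNReal.ofReal b :=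
    ⟨_, ENNReal.toReal_nonneg, (ENNReal.ofReal_toReal f1.ne).symm⟩
  have hK0 : 0 ≤ a + t * b := by positivity
  rcases hK0.eq_or_lt with hK | hK
  · have tb : 0 ≤ t * b := by positivity
    have a0 : a = 0 := by linarith
    have b0 : b = 0 := by
      have : t * b = 0 := by linarith
      rcases mul_eq_zero.1 this with h | h
      · exact absurd h ht.ne'
      · exact h
    rw [a0, ENNReal.ofReal_zero, eLpNorm_eq_zero_iff h0.aestronglyMeasurable (by simp)] at hae
    rw [b0, ENNReal.ofReal_zero, eLpNorm_eq_zero_iff h1.aestronglyMeasurable (by simp)] at hbe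
    refine ⟨fun _ => 0, fun _ => 0, memV_zero _, memV_zero _, ?_, by simp⟩
    filter_upwards [h, hae, hbe] with z e1 e2 e3
    rw [e1, e2, e3]; simp
  · set K := a + t * b with hKd
    set l := K / t ^ 2 with hl
    have hlp : 0 < l := by positivity
    have hbK : b ≤ K / t := by rw [le_div_iff₀ ht]; nlinarith
    have haK : a ≤ K := by have : 0 ≤ t * b := by positivity
                           linarith
    set J := ∫⁻ z, ENNReal.ofReal (hub l (u z + v z)) ∂(PP μ) with hJ
    have hJb : J ≤ ENNReal.ofReal (4 * K ^ 2 / t ^ 2) := by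
      refine (J_bound (W := fun z => u z + v z) hlp h1 h0 h).trans ?_
      rw [hae, hbe, ← ENNReal.ofReal_mul (by positivity), ← ENNReal.ofReal_pow hb,
        show (2 : ℝ≥0∞) = ENNReal.ofReal 2 by simp, ← ENNReal.ofReal_mul (by norm_num),
        ← ENNReal.ofReal_add (by positivity) (by positivity)]
      apply ENNReal.ofReal_le_ofReal
      calc 2 * l * a + 2 * b ^ 2 ≤ 2 * l * K + 2 * (K / t) ^ 2 := by gcongr
        _ = _ := by rw [hl]; field_simp; ring
    obtain ⟨G0, G1, g0, g1, e, n0, n1⟩ := construct hu hv hlp hJ (ne_top_of_le_ne_top ENNReal.ofReal_ne_top hJb)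
    refine ⟨G0, G1, g0, g1, ae_of_all _ e, ?_⟩
    have m0 : eLpNorm G0 1 (PP μ) ≤ ENNReal.ofReal (96 * K) := by
      refine n0.trans ((mul_le_mul_right hJb _).trans ?_)
      rw [← ENNReal.ofReal_mul (by positivity)]
      apply ENNReal.ofReal_le_ofReal
      rw [hl]; apply le_of_eq; field_simp; ring
    have m1 : eLpNorm G1 2 (PP μ) ≤ ENNReal.ofReal (6 * K / t) := by
      refine n1.trans ?_
      calc (8 * J) ^ ((1:ℝ)/2) ≤ ((ENNReal.ofReal (6 * K / t)) ^ 2) ^ ((1:ℝ)/2) := by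
            gcongr
            refine (mul_le_mul_right hJb _).trans ?_
            rw [show (8 : ℝ≥0∞) = ENNReal.ofReal 8 by simp, ← ENNReal.ofReal_mul (by positivity),
              ← ENNReal.ofReal_pow (by positivity)]
            apply ENNReal.ofReal_le_ofReal
            rw [div_pow, ← mul_div_assoc]
            gcongr
            nlinarith [sq_nonneg K]
        _ = _ := by
            rw [← ENNReal.rpow_natCast, ← ENNReal.rpow_mul]; norm_num
    calc _ ≤ ENNReal.ofReal (96 * K) + ENNReal.ofReal t * ENNReal.ofReal (6 * K / t) := by gcongr
      _ = ENNReal.ofReal (102 * K) := by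
          rw [← ENNReal.ofReal_mul ht.le, ← ENNReal.ofReal_add (by positivity) (by positivity)]
          congr 1; field_simp; ring
      _ = _ := by
          rw [hae, hbe, ← ENNReal.ofReal_mul ht.le, ← ENNReal.ofReal_add ha (by positivity),
            ← ENNReal.ofReal_mul (by norm_num)]

end Part7

end KC

end Helpers

/-- **K-closedness of `(V^1_1(Ω^∞, L¹(ℝ)), V^2_1(Ω^∞, L²(ℝ)))` in
`(L¹(Ω^∞, L¹(ℝ)), L²(Ω^∞, L²(ℝ)))`** (Theorem `bourgu1m` of the paper for `m = 1`).
The infinite product measure `π` on `Ω^∞ = ℕ → Ω` is characterized by its finite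
marginals. -/
theorem kClosed_V11_V21 :
    ∃ C : ℝ, 0 < C ∧
      ∀ (Ω : Type u) [MeasurableSpace Ω] (μ : Measure Ω) [IsProbabilityMeasure μ]
        (π : Measure (ℕ → Ω)) [IsProbabilityMeasure π],
        (∀ n : ℕ, Measure.map (fun x : ℕ → Ω => fun k : Fin n => x k) π
            = Measure.pi fun _ : Fin n => μ) →
        ∀ (F F₀ F₁ : (ℕ → Ω) → ℝ → ℝ) (t : ℝ), 0 < t →
        (∃ u v : (ℕ → Ω) → ℝ → ℝ,
          MemV1inf μ (nrmL1L1 π) u ∧ MemV1inf μ (nrmL2L2 π) v ∧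
          ∀ᵐ z ∂(π.prod volume), F z.1 z.2 = u z.1 z.2 + v z.1 z.2) →
        Measurable (Function.uncurry F₀) → Measurable (Function.uncurry F₁) →
        nrmL1L1 π F₀ < ⊤ → nrmL2L2 π F₁ < ⊤ →
        (∀ᵐ z ∂(π.prod volume), F z.1 z.2 = F₀ z.1 z.2 + F₁ z.1 z.2) →
        ∃ G₀ G₁ : (ℕ → Ω) → ℝ → ℝ,
          MemV1inf μ (nrmL1L1 π) G₀ ∧ MemV1inf μ (nrmL2L2 π) G₁ ∧
          (∀ᵐ z ∂(π.prod volume), F z.1 z.2 = G₀ z.1 z.2 + G₁ z.1 z.2) ∧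
          nrmL1L1 π G₀ + ENNReal.ofReal t * nrmL2L2 π G₁
            ≤ ENNReal.ofReal C * (nrmL1L1 π F₀ + ENNReal.ofReal t * nrmL2L2 π F₁) := by
  refine ⟨102, by norm_num, ?_⟩
  intro Ω _ μ _ π _ hπ F F₀ F₁ t ht huv hm0 hm1 hf0 hf1 hF
  obtain ⟨u, v, hu, hv, hFe⟩ := huv
  have hpi := KC.pi_unique μ π hπ
  subst hpi
  rw [KC.nrm1_eq hm0] at hf0
  rw [KC.nrm2_eq hm1] at hf1
  have hu' := KC.memV_of (p := 1) (fun F hF => KC.nrm1_eq hF) hu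
  have hv' := KC.memV_of (p := 2) (fun F hF => KC.nrm2_eq hF) hv
  obtain ⟨G0, G1, g0, g1, e, hn⟩ := KC.main_PP hu' hv' ht hm0 hm1 hf0 hf1 (by
    filter_upwards [hFe, hF] with z h1 h2
    exact h1.symm.trans h2)
  refine ⟨fun x s => G0 (x, s), fun x s => G1 (x, s),
    KC.memV_to (p := 1) (fun F hF => KC.nrm1_eq hF) g0,
    KC.memV_to (p := 2) (fun F hF => KC.nrm2_eq hF) g1, ?_, ?_⟩
  · filter_upwards [hFe, e] with z h1 h2
    exact h1.trans h2
  · rw [KC.nrm1_eq hm0, KC.nrm2_eq hm1, KC.nrm1_eq (F := fun x s => G0 (x, s)) g0.1,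
      KC.nrm2_eq (F := fun x s => G1 (x, s)) g1.1]
    exact hn
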